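/- arXiv:1312.2516 — 3 statements merged into one kernel-verified Lean document; each statement's English description precedes it below -/
import Mathlib

section
/- (First variation of polarity.) Let u(t,x) ∈ C²(ℝ × (ℝⁿ∖{0})) be such that u_t = u(t,·) ∈ S₂(ℝⁿ) for each t, and let w(t,·) = P(u_t) be the fiberwise polar. Then for any t and any y ≠ 0 such that w(t,·) is not linear on the segment [0,y], one has (∂/∂t) log w(t,y) = −(∂/∂t) log u(t, ∇°w(t,·)(y)). -/
open scoped ENNReal RealInnerProductSpace
open Set

noncomputable section

/-- Euclidean space `ℝⁿ`. -/
abbrev Euc (n : ℕ) := EuclideanSpace ℝ (Fin n)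

/-- The polarity transform `𝒫`:
`(Pf)(y) = inf {c ≥ 0 : ⟨x,y⟩ ≤ 1 + c·f(x) for all x}`, with `inf ∅ = ∞`.
(Nonnegativity of `c` is automatic since we work in `ℝ≥0∞`.) -/
def polarT {n : ℕ} (f : Euc n → ℝ≥0∞) (y : Euc n) : ℝ≥0∞ :=
  sInf {c : ℝ≥0∞ | ∀ x : Euc n, ENNReal.ofReal ⟪x, y⟫ ≤ 1 + c * f x}

/-- The class `Cvx₀(ℝⁿ)` of geometric convex functions: lower semicontinuous, convex,
nonnegative (automatic), vanishing at the origin. -/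
def GeomConvexOn {n : ℕ} (f : Euc n → ℝ≥0∞) : Prop :=
  (∀ x y : Euc n, ∀ a b : ℝ, 0 ≤ a → 0 ≤ b → a + b = 1 →
    f (a • x + b • y) ≤ ENNReal.ofReal a * f x + ENNReal.ofReal b * f y) ∧
  LowerSemicontinuous f ∧ f 0 = 0

/-- The polar set `K° = {y : ⟨x,y⟩ ≤ 1 ∀ x ∈ K}`. -/
def polarSet {n : ℕ} (K : Set (Euc n)) : Set (Euc n) :=
  {y : Euc n | ∀ x ∈ K, ⟪x, y⟫ ≤ 1}

/-- The Legendre transform `(Lf)(y) = sup_x (⟨x,y⟩ - f(x))` of a `[0,∞]`-valued function,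
with values in `[0,∞]` (for `f` with `f(0) = 0` the supremum is automatically `≥ 0`,
so the `ℝ≥0∞`-valued truncated subtraction computes the genuine Legendre transform). -/
def legendreT {n : ℕ} (f : Euc n → ℝ≥0∞) (y : Euc n) : ℝ≥0∞ :=
  ⨆ x : Euc n, ENNReal.ofReal ⟪x, y⟫ - f x

/-- The usual subdifferential `∂g(x) = {y : g(z) ≥ g(x) + ⟨z - x, y⟩ ∀ z}`,
stated in `EReal` to accommodate `[0,∞]`-valued functions. -/
def subdiff {n : ℕ} (g : Euc n → ℝ≥0∞) (x : Euc n) : Set (Euc n) :=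
  {y : Euc n | ∀ z : Euc n, (g x : EReal) + ((⟪z - x, y⟫ : ℝ) : EReal) ≤ (g z : EReal)}

/-- The polar subdifferential `∂°f(x) = {y ∈ dom(Pf) : Pf(y)·f(x) = ⟨x,y⟩ - 1}`. -/
def polarSubdiff {n : ℕ} (f : Euc n → ℝ≥0∞) (x : Euc n) : Set (Euc n) :=
  {y : Euc n | polarT f y ≠ ∞ ∧
    (polarT f y : EReal) * (f x : EReal) = ((⟪x, y⟫ - 1 : ℝ) : EReal)}

/-- `g` restricted to the segment `[0,x]` is linear (i.e. `g(t•x) = c·t` for `t ∈ [0,1]`). -/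
def RayLinear {n : ℕ} (g : Euc n → ℝ≥0∞) (x : Euc n) : Prop :=
  ∃ c : ℝ, 0 ≤ c ∧ ∀ t : ℝ, t ∈ Icc (0:ℝ) 1 → g (t • x) = ENNReal.ofReal (c * t)

/-- `g` is not linear on `[0,x+]`: there is no `t > 1` such that `g` is linear on `[0,t•x]`. -/
def NotLinearPlus {n : ℕ} (g : Euc n → ℝ≥0∞) (x : Euc n) : Prop :=
  ¬ ∃ t : ℝ, 1 < t ∧ RayLinear g (t • x)

/-- `f` is nonlinear at infinity: for every ray `ℝ⁺x`, `t ↦ f(tx)` is finite everywhere and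
is not squeezed between `at - b` and `at` for any `a ≥ 0`, `b > 0`. -/
def NonlinearAtInfinity {n : ℕ} (f : Euc n → ℝ≥0∞) : Prop :=
  ∀ x : Euc n, x ≠ 0 →
    (∀ t : ℝ, 0 ≤ t → f (t • x) ≠ ∞) ∧
    ¬ ∃ a b : ℝ, 0 ≤ a ∧ 0 < b ∧ ∀ t : ℝ, 0 ≤ t →
        ENNReal.ofReal (a * t - b) ≤ f (t • x) ∧ f (t • x) ≤ ENNReal.ofReal (a * t)

/-- The class `S₁(ℝⁿ)`: geometric convex functions which are finite-valued, continuously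
differentiable off the origin, and strictly convex. -/
def S1 {n : ℕ} (f : Euc n → ℝ≥0∞) : Prop :=
  GeomConvexOn f ∧ (∀ x, f x ≠ ∞) ∧
  ContDiffOn ℝ 1 (fun x => (f x).toReal) ({0}ᶜ : Set (Euc n)) ∧
  StrictConvexOn ℝ (univ : Set (Euc n)) (fun x => (f x).toReal)

/-- The Hessian of a real-valued function, as the derivative of the gradient map. -/
def hess {n : ℕ} (g : Euc n → ℝ) (x : Euc n) : Euc n →L[ℝ] Euc n :=
  fderiv ℝ (fun z => gradient g z) x

/-- The class `S₂(ℝⁿ)`: geometric convex functions which are finite-valued, strictly convex,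
twice continuously differentiable off the origin with positive definite Hessian there. -/
def S2 {n : ℕ} (f : Euc n → ℝ≥0∞) : Prop :=
  GeomConvexOn f ∧ (∀ x, f x ≠ ∞) ∧
  StrictConvexOn ℝ (univ : Set (Euc n)) (fun x => (f x).toReal) ∧
  ContDiffOn ℝ 2 (fun x => (f x).toReal) ({0}ᶜ : Set (Euc n)) ∧
  ∀ x : Euc n, x ≠ 0 → ∀ v : Euc n, v ≠ 0 →
    0 < ⟪v, hess (fun z => (f z).toReal) x v⟫

open scoped Topology

section RealConvex

variable {E : Type*} [NormedAddCommGroup E] [NormedSpace ℝ E] {g : E → ℝ}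

lemma StrictConvexOn.pos_of_nonneg (hg : StrictConvexOn ℝ univ g) (h0 : g 0 = 0)
    (hnn : ∀ x, 0 ≤ g x) {x : E} (hx : x ≠ 0) : 0 < g x := by
  have h := hg.2 (mem_univ x) (mem_univ (0 : E)) hx (show (0 : ℝ) < 1 / 2 by norm_num)
    (show (0 : ℝ) < 1 / 2 by norm_num) (by norm_num)
  have h1 := hnn ((1 / 2 : ℝ) • x + (1 / 2 : ℝ) • (0 : E))
  simp only [smul_eq_mul, h0] at h
  linarith

/-- A convex function that vanishes at the origin and is positive elsewhere grows at least
linearly away from the origin. -/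
lemma ConvexOn.exists_mul_norm_le [FiniteDimensional ℝ E] (hg : ConvexOn ℝ univ g)
    (h0 : g 0 = 0) (hpos : ∀ x ≠ 0, 0 < g x) (hc : ContinuousOn g {0}ᶜ) {r : ℝ} (hr : 0 < r) :
    ∃ m > 0, ∀ x, r ≤ ‖x‖ → m * ‖x‖ ≤ g x := by
  have hS : IsCompact (Metric.sphere (0 : E) r) := isCompact_sphere _ _
  have hne : ∀ x ∈ Metric.sphere (0 : E) r, x ≠ 0 := by
    rintro x hx rfl
    simp at hx
    exact hr.ne hx
  have hlow : ∃ m > 0, ∀ x ∈ Metric.sphere (0 : E) r, m ≤ g x :=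
    hS.exists_forall_le' (hc.mono hne) fun x hx => hpos x (hne x hx)
  obtain ⟨m, hm, hle⟩ := hlow
  refine ⟨m / r, by positivity, fun x hx => ?_⟩
  have hx0 : 0 < ‖x‖ := hr.trans_le hx
  have hz : (r / ‖x‖) • x ∈ Metric.sphere (0 : E) r := by
    simp [norm_smul, abs_of_pos hr, hx0.ne']
  have h1 := hle _ hz
  have h2 := hg.2 (mem_univ x) (mem_univ (0 : E)) (show 0 ≤ r / ‖x‖ by positivity)
    (show 0 ≤ 1 - r / ‖x‖ by rw [sub_nonneg, div_le_one hx0]; exact hx) (by ring)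
  simp only [smul_zero, add_zero, h0, smul_eq_mul, mul_zero] at h2
  have h3 : m ≤ r / ‖x‖ * g x := h1.trans h2
  rw [div_mul_eq_mul_div, le_div_iff₀ hx0] at h3
  rw [div_mul_eq_mul_div, div_le_iff₀ hr]
  linarith

lemma ConvexOn.add_fderiv_le {g' : E →L[ℝ] ℝ} (hg : ConvexOn ℝ univ g) {x : E}
    (hd : HasFDerivAt g g' x) (z : E) : g x + g' (z - x) ≤ g z := by
  have hline := hg.comp_affineMap (AffineMap.lineMap x z : ℝ →ᵃ[ℝ] E)
  have hder : HasDerivAt (g ∘ (AffineMap.lineMap x z : ℝ →ᵃ[ℝ] E)) (g' (z - x)) 0 := by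
    have h1 : HasDerivAt (AffineMap.lineMap x z : ℝ →ᵃ[ℝ] E) (z - x) 0 :=
      AffineMap.hasDerivAt_lineMap
    refine HasFDerivAt.comp_hasDerivAt (0 : ℝ) ?_ h1
    simpa using hd
  have h := hline.le_slope_of_hasDerivAt (mem_univ (0 : ℝ)) (mem_univ (1 : ℝ)) one_pos hder
  simp [slope_def_field] at h
  rw [map_sub]
  linarith

/-- If a convex function is nonpositive at `x₀` and positive on a sphere around `x₀`, it is
positive outside that sphere. -/
lemma ConvexOn.pos_of_pos_on_sphere (hg : ConvexOn ℝ univ g) {x₀ : E} {r : ℝ} (hr : 0 < r)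
    (h0 : g x₀ ≤ 0) (hS : ∀ x ∈ Metric.sphere x₀ r, 0 < g x) {x : E} (hx : r ≤ dist x x₀) :
    0 < g x := by
  rw [dist_eq_norm] at hx
  have hx0 : 0 < ‖x - x₀‖ := hr.trans_le hx
  have ha : 0 < r / ‖x - x₀‖ := by positivity
  have ha1 : 0 ≤ 1 - r / ‖x - x₀‖ := by rw [sub_nonneg, div_le_one hx0]; exact hx
  have h2 := hg.2 (mem_univ x) (mem_univ x₀) ha.le ha1 (by ring)
  have hz : (r / ‖x - x₀‖) • x + (1 - r / ‖x - x₀‖) • x₀ ∈ Metric.sphere x₀ r := by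
    have : (r / ‖x - x₀‖) • x + (1 - r / ‖x - x₀‖) • x₀ - x₀ = (r / ‖x - x₀‖) • (x - x₀) := by
      module
    rw [mem_sphere_iff_norm, this, norm_smul, Real.norm_eq_abs, abs_of_pos ha]
    field_simp
  have h3 := hS _ hz
  simp only [smul_eq_mul] at h2
  have h4 := mul_nonneg ha1 (neg_nonneg.2 h0)
  have h5 : 0 < r / ‖x - x₀‖ * g x := by linarith
  exact (mul_pos_iff_of_pos_left ha).1 h5

/-- Envelope theorem: if the increments of `L` at `t` dominate those of `s ↦ -h (s, x₀)` and are
dominated by those of `s ↦ -h (s, x)` with `x` arbitrarily close to `x₀`, then `L` has the same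
derivative at `t` as `s ↦ -h (s, x₀)`. -/
lemma hasDerivAt_of_envelope {h : ℝ × E → ℝ} {D : ℝ × E →L[ℝ] ℝ} {L : ℝ → ℝ} {t : ℝ} {x₀ : E}
    (hh : HasStrictFDerivAt h D (t, x₀))
    (hlow : ∀ᶠ s in 𝓝 t, -(h (s, x₀) - h (t, x₀)) ≤ L s - L t)
    (hup : ∀ ε > 0, ∀ᶠ s in 𝓝 t, ∃ x, dist x x₀ < ε ∧ L s - L t ≤ -(h (s, x) - h (t, x))) :
    HasDerivAt L (-D (1, 0)) t := by
  rw [hasDerivAt_iff_isLittleO, Asymptotics.isLittleO_iff]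
  intro c hc
  have hb := (Asymptotics.isLittleO_iff.1 hh.isLittleO) hc
  obtain ⟨ε, hε, hball⟩ := Metric.eventually_nhds_iff.1 hb
  have key : ∀ s x, dist s t < ε → dist x x₀ < ε →
      |h (s, x) - h (t, x) - (s - t) * D (1, 0)| ≤ c * |s - t| := by
    intro s x hs hx
    have := @hball ((s, x), (t, x)) (by
      simp only [Prod.dist_eq, dist_self]
      simp [hs, hx])
    have e : ((s, x) - (t, x) : ℝ × E) = (s - t) • ((1 : ℝ), (0 : E)) := by simp
    rw [e, map_smul, norm_smul] at this
    simpa [Prod.norm_def] using this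
  filter_upwards [hlow, hup ε hε, Metric.ball_mem_nhds t hε] with s h1 h2 hs
  obtain ⟨x, hx, h2⟩ := h2
  have k1 := abs_le.1 (key s x₀ hs (by simpa using hε))
  have k2 := abs_le.1 (key s x hs hx)
  simp only [smul_eq_mul, Real.norm_eq_abs]
  rw [abs_le]
  constructor <;> linarith [k1.1, k1.2, k2.1, k2.2]

end RealConvex

section Polarity

variable {n : ℕ} {f : Euc n → ℝ≥0∞}

lemma polarT_le_ofReal (hf : ∀ x, f x ≠ ∞) {y : Euc n} {c : ℝ} (hc : 0 ≤ c)
    (h : ∀ x, ⟪x, y⟫ ≤ 1 + c * (f x).toReal) : polarT f y ≤ ENNReal.ofReal c := by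
  refine sInf_le fun x => ?_
  rw [← ENNReal.ofReal_toReal (hf x), ← ENNReal.ofReal_mul hc, ← ENNReal.ofReal_one,
    ← ENNReal.ofReal_add zero_le_one (by positivity)]
  exact ENNReal.ofReal_le_ofReal (h x)

lemma ofReal_inner_le (hf : ∀ x, f x ≠ ∞) {y : Euc n} (hW : polarT f y ≠ ∞) (x : Euc n) :
    ENNReal.ofReal ⟪x, y⟫ ≤ 1 + polarT f y * f x := by
  have hcl : IsClosed {c : ℝ≥0∞ | ∀ x : Euc n, ENNReal.ofReal ⟪x, y⟫ ≤ 1 + c * f x} := by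
    simp only [ofPred_forall]
    exact isClosed_iInter fun x =>
      isClosed_le continuous_const (continuous_const.add (ENNReal.continuous_mul_const (hf x)))
  have hne : {c : ℝ≥0∞ | ∀ x : Euc n, ENNReal.ofReal ⟪x, y⟫ ≤ 1 + c * f x}.Nonempty := by
    by_contra h
    rw [not_nonempty_iff_eq_empty] at h
    simp [polarT, h] at hW
  exact hcl.csInf_mem hne (OrderBot.bddBelow _) x

lemma inner_le_one_add (hf : ∀ x, f x ≠ ∞) {y : Euc n} (hW : polarT f y ≠ ∞) (x : Euc n) :
    ⟪x, y⟫ ≤ 1 + (polarT f y).toReal * (f x).toReal := by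
  have h := ofReal_inner_le hf hW x
  rw [← ENNReal.ofReal_toReal (hf x), ← ENNReal.ofReal_toReal hW,
    ← ENNReal.ofReal_mul ENNReal.toReal_nonneg, ← ENNReal.ofReal_one,
    ← ENNReal.ofReal_add zero_le_one (by positivity)] at h
  exact (ENNReal.ofReal_le_ofReal_iff (by positivity)).1 h

lemma polarT_toReal_le (hf : ∀ x, f x ≠ ∞) {y : Euc n} {c : ℝ} (hc : 0 ≤ c)
    (h : ∀ x, ⟪x, y⟫ ≤ 1 + c * (f x).toReal) : (polarT f y).toReal ≤ c :=
  ENNReal.toReal_le_of_le_ofReal hc (polarT_le_ofReal hf hc h)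

namespace S2

lemma ne_top (hf : S2 f) (x : Euc n) : f x ≠ ∞ := hf.2.1 x

lemma strictConvexOn (hf : S2 f) : StrictConvexOn ℝ univ fun x => (f x).toReal := hf.2.2.1

lemma toReal_zero (hf : S2 f) : (f 0).toReal = 0 := by rw [hf.1.2.2, ENNReal.toReal_zero]

lemma toReal_pos (hf : S2 f) {x : Euc n} (hx : x ≠ 0) : 0 < (f x).toReal :=
  hf.strictConvexOn.pos_of_nonneg hf.toReal_zero (fun _ => ENNReal.toReal_nonneg) hx

lemma continuousOn (hf : S2 f) : ContinuousOn (fun x => (f x).toReal) {0}ᶜ :=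
  hf.2.2.2.1.continuousOn

lemma exists_mul_norm_le (hf : S2 f) {r : ℝ} (hr : 0 < r) :
    ∃ m > 0, ∀ x, r ≤ ‖x‖ → m * ‖x‖ ≤ (f x).toReal :=
  hf.strictConvexOn.convexOn.exists_mul_norm_le hf.toReal_zero (fun _ => hf.toReal_pos)
    hf.continuousOn hr

lemma polarT_ne_top (hf : S2 f) (y : Euc n) : polarT f y ≠ ∞ := by
  have hy : 0 < ‖y‖ + 1 := by positivity
  obtain ⟨m, hm, h⟩ := hf.exists_mul_norm_le (r := 1 / (‖y‖ + 1)) (by positivity)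
  refine ne_top_of_le_ne_top ENNReal.ofReal_ne_top
    (polarT_le_ofReal hf.ne_top (c := ‖y‖ / m) (by positivity) fun x => ?_)
  have hcs := real_inner_le_norm x y
  rcases le_total (1 / (‖y‖ + 1)) ‖x‖ with hx | hx
  · have h1 := mul_le_mul_of_nonneg_left (h x hx) (show 0 ≤ ‖y‖ / m by positivity)
    have h2 : ‖y‖ / m * (m * ‖x‖) = ‖x‖ * ‖y‖ := by field_simp
    linarith
  · rw [le_div_iff₀ hy] at hx
    have : 0 ≤ ‖y‖ / m * (f x).toReal := by positivity
    nlinarith [norm_nonneg x]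

lemma polarT_toReal_pos (hf : S2 f) {y : Euc n} (hy : y ≠ 0) : 0 < (polarT f y).toReal := by
  refine lt_of_le_of_ne ENNReal.toReal_nonneg fun h => ?_
  have h1 := inner_le_one_add hf.ne_top (hf.polarT_ne_top y) ((2 / ‖y‖ ^ 2) • y)
  have h2 : 0 < ‖y‖ := norm_pos_iff.2 hy
  rw [← h, inner_smul_left, real_inner_self_eq_norm_sq] at h1
  simp at h1
  field_simp at h1
  norm_num at h1

/-- Polarity is an involution on `S₂`, evaluated off the origin. -/
lemma polarT_polarT (hf : S2 f) {x : Euc n} (hx : x ≠ 0) : polarT (polarT f) x = f x := by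
  apply le_antisymm
  · refine sInf_le fun y => ?_
    rw [real_inner_comm, mul_comm]
    exact ofReal_inner_le hf.ne_top (hf.polarT_ne_top y) x
  · refine le_sInf fun c hc => ?_
    rcases eq_or_ne c ∞ with rfl | hct
    · exact le_top
    have hd : DifferentiableAt ℝ (fun x => (f x).toReal) x :=
      (hf.2.2.2.1.contDiffAt (isOpen_compl_singleton.mem_nhds hx)).differentiableAt (by norm_num)
    set p := gradient (fun x => (f x).toReal) x with hp
    have htan : ∀ z, (f x).toReal + ⟪p, z - x⟫ ≤ (f z).toReal := fun z => by
      have := hf.strictConvexOn.convexOn.add_fderiv_le hd.hasGradientAt.hasFDerivAt z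
      rwa [InnerProductSpace.toDual_apply_apply] at this
    have hA : 0 < ⟪p, x⟫ - (f x).toReal := by
      have h1 := htan ((1 / 2 : ℝ) • x)
      have h2 := hf.strictConvexOn.2 (mem_univ x) (mem_univ 0) hx
        (show (0 : ℝ) < 1 / 2 by norm_num) (show (0 : ℝ) < 1 / 2 by norm_num) (by norm_num)
      simp only [smul_zero, add_zero, hf.toReal_zero, smul_eq_mul] at h2
      rw [inner_sub_right, inner_smul_right] at h1
      linarith
    set A := ⟪p, x⟫ - (f x).toReal with hAdef
    have hw : (polarT f (A⁻¹ • p)).toReal ≤ A⁻¹ := by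
      refine polarT_toReal_le hf.ne_top (by positivity) fun z => ?_
      have h1 := htan z
      rw [inner_sub_right] at h1
      rw [inner_smul_right, real_inner_comm]
      have h2 : ⟪p, z⟫ ≤ A + (f z).toReal := by linarith
      calc A⁻¹ * ⟪p, z⟫ ≤ A⁻¹ * (A + (f z).toReal) := by gcongr
        _ = 1 + A⁻¹ * (f z).toReal := by field_simp
    have h3 := hc (A⁻¹ • p)
    rw [← ENNReal.ofReal_toReal hct, ← ENNReal.ofReal_toReal (hf.polarT_ne_top (A⁻¹ • p)),
      ← ENNReal.ofReal_mul ENNReal.toReal_nonneg, ← ENNReal.ofReal_one,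
      ← ENNReal.ofReal_add zero_le_one (by positivity),
      ENNReal.ofReal_le_ofReal_iff (by positivity), inner_smul_left] at h3
    have h4 := mul_le_mul_of_nonneg_left hw (ENNReal.toReal_nonneg (a := c))
    have h5 : A⁻¹ * ⟪p, x⟫ ≤ 1 + c.toReal * A⁻¹ := by
      simp at h3
      linarith
    have h6 : ⟪p, x⟫ ≤ A + c.toReal := by
      have := mul_le_mul_of_nonneg_left h5 hA.le
      have e1 : A * (A⁻¹ * ⟪p, x⟫) = ⟪p, x⟫ := by field_simp
      have e2 : A * (1 + c.toReal * A⁻¹) = A + c.toReal := by field_simp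
      linarith
    rw [← ENNReal.toReal_le_toReal (hf.ne_top x) hct]
    linarith

/-- If `Pf` is not linear on `[0, y]`, the supremum defining `Pf(y)` is attained. -/
lemma exists_polarT_mul_eq (hf : S2 f) {y : Euc n} (hlin : ¬ RayLinear (polarT f) y) :
    ∃ x, (polarT f y).toReal * (f x).toReal = ⟪x, y⟫ - 1 := by
  set W := (polarT f y).toReal with hW
  have hW0 : 0 ≤ W := ENNReal.toReal_nonneg
  have hle := inner_le_one_add hf.ne_top (hf.polarT_ne_top y)
  have hs : ∃ s ∈ Icc (0 : ℝ) 1, polarT f (s • y) ≠ ENNReal.ofReal (W * s) := by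
    by_contra! h
    exact hlin ⟨W, hW0, h⟩
  obtain ⟨s, ⟨hs0, hs1⟩, hsne⟩ := hs
  have hle' := inner_le_one_add hf.ne_top (hf.polarT_ne_top (s • y))
  set d := (polarT f (s • y)).toReal with hd
  have hd0 : 0 ≤ d := ENNReal.toReal_nonneg
  have hdlt : d < W * s := by
    refine lt_of_le_of_ne ?_ fun h => hsne ?_
    · refine polarT_toReal_le hf.ne_top (by positivity) fun x => ?_
      rw [inner_smul_right]
      have := mul_le_mul_of_nonneg_left (hle x) hs0
      linarith
    · rw [← h, hd, ENNReal.ofReal_toReal (hf.polarT_ne_top _)]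
  have hspos : 0 < s := by
    rcases hs0.eq_or_lt with h | h
    · rw [← h] at hdlt; linarith
    · exact h
  have hdW : d / s < W := by rwa [div_lt_iff₀ hspos]
  obtain ⟨c, hc1, hc2⟩ := exists_between hdW
  have hc0 : 0 ≤ c := (div_nonneg hd0 hspos.le).trans hc1.le
  have hgap : 0 < c - d / s := by linarith
  obtain ⟨m, hm, hgrow⟩ := hf.exists_mul_norm_le one_pos
  have hbig : ∃ R : ℝ, ∀ x : Euc n, 1 + c * (f x).toReal < ⟪x, y⟫ → ‖x‖ ≤ R := by
    refine ⟨max 1 ((1 / s - 1) / (c - d / s) / m), fun x hx => ?_⟩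
    rcases le_total ‖x‖ 1 with h | h
    · exact h.trans (le_max_left _ _)
    refine le_trans ?_ (le_max_right _ _)
    have h1 := hle' x
    rw [inner_smul_right] at h1
    have h2 : ⟪x, y⟫ ≤ 1 / s + d / s * (f x).toReal := by
      rw [div_mul_eq_mul_div, ← add_div, le_div_iff₀ hspos]
      linarith
    rw [le_div_iff₀ hm, le_div_iff₀ hgap]
    have h3 := mul_le_mul_of_nonneg_right (hgrow x h) hgap.le
    linarith
  obtain ⟨R, hR⟩ := hbig
  have hKc : IsCompact {x : Euc n | ‖x‖ ≤ R ∧ 1 ≤ ⟪x, y⟫} := by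
    have h1 : {x : Euc n | ‖x‖ ≤ R ∧ 1 ≤ ⟪x, y⟫} =
        Metric.closedBall 0 R ∩ {x : Euc n | 1 ≤ ⟪x, y⟫} := by
      ext x; simp
    rw [h1]
    exact (isCompact_closedBall _ _).inter_right
      (isClosed_le continuous_const (by fun_prop))
  have hK0 : ∀ x ∈ {x : Euc n | ‖x‖ ≤ R ∧ 1 ≤ ⟪x, y⟫}, x ≠ 0 := by
    rintro x ⟨-, hx⟩ rfl
    norm_num at hx
  have hex : ∃ x, 1 + c * (f x).toReal < ⟪x, y⟫ := by
    by_contra! h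
    exact absurd (polarT_toReal_le hf.ne_top hc0 h) (not_le.2 hc2)
  have hin : ∀ x, 1 + c * (f x).toReal < ⟪x, y⟫ → x ∈ {x : Euc n | ‖x‖ ≤ R ∧ 1 ≤ ⟪x, y⟫} :=
    fun x hx => ⟨hR x hx, by
      have : 0 ≤ c * (f x).toReal := by positivity
      linarith⟩
  have hcont : ContinuousOn (fun x => (⟪x, y⟫ - 1) / (f x).toReal)
      {x : Euc n | ‖x‖ ≤ R ∧ 1 ≤ ⟪x, y⟫} :=
    ContinuousOn.div (by fun_prop) (hf.continuousOn.mono hK0)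
      fun x hx => (hf.toReal_pos (hK0 x hx)).ne'
  obtain ⟨x₁, hx₁⟩ := hex
  obtain ⟨x₀, hx₀, hmax⟩ := hKc.exists_isMaxOn ⟨x₁, hin x₁ hx₁⟩ hcont
  have hf0 := hf.toReal_pos (hK0 x₀ hx₀)
  have hf1 := hf.toReal_pos (hK0 x₁ (hin x₁ hx₁))
  refine ⟨x₀, le_antisymm ?_ (by linarith [hle x₀])⟩
  rw [← le_div_iff₀ hf0]
  have hcM : c ≤ (⟪x₀, y⟫ - 1) / (f x₀).toReal := by
    refine le_trans ?_ (hmax (hin x₁ hx₁))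
    rw [le_div_iff₀ hf1]
    linarith
  refine polarT_toReal_le hf.ne_top (hc0.trans hcM) fun x => ?_
  by_cases hx : 1 + c * (f x).toReal < ⟪x, y⟫
  · have h1 := hmax (hin x hx)
    have h2 := (div_le_iff₀ (hf.toReal_pos (hK0 x (hin x hx)))).1 h1
    linarith
  · have := mul_le_mul_of_nonneg_right hcM (ENNReal.toReal_nonneg (a := f x))
    linarith

lemma ne_zero_of_polarT_mul_eq {x y : Euc n}
    (hx : (polarT f y).toReal * (f x).toReal = ⟪x, y⟫ - 1) : x ≠ 0 := by
  rintro rfl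
  have : 0 ≤ (polarT f y).toReal * (f 0).toReal := by positivity
  rw [hx] at this
  norm_num at this

lemma convexOn_mul_sub_inner (hf : S2 f) (y : Euc n) {c : ℝ} (hc : 0 ≤ c) :
    ConvexOn ℝ univ fun x => c * (f x).toReal - ⟪x, y⟫ + 1 := by
  refine ⟨convex_univ, fun x _ z _ a b ha hb hab => ?_⟩
  have h := mul_le_mul_of_nonneg_left
    (hf.strictConvexOn.convexOn.2 (mem_univ x) (mem_univ z) ha hb hab) hc
  simp only [smul_eq_mul, inner_add_left, inner_smul_left, conj_trivial] at h ⊢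
  have hb' : b = 1 - a := by linarith
  subst hb'
  linarith

/-- The supremum defining `Pf(y)` is attained at one point at most. -/
lemma eq_of_polarT_mul_eq (hf : S2 f) {x z y : Euc n} (hy : y ≠ 0)
    (hx : (polarT f y).toReal * (f x).toReal = ⟪x, y⟫ - 1)
    (hz : (polarT f y).toReal * (f z).toReal = ⟪z, y⟫ - 1) : x = z := by
  by_contra hne
  have h1 := hf.strictConvexOn.2 (mem_univ x) (mem_univ z) hne
    (show (0 : ℝ) < 1 / 2 by norm_num) (show (0 : ℝ) < 1 / 2 by norm_num) (by norm_num)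
  have h2 := mul_lt_mul_of_pos_left h1 (hf.polarT_toReal_pos hy)
  have h3 := inner_le_one_add hf.ne_top (hf.polarT_ne_top y)
    ((1 / 2 : ℝ) • x + (1 / 2 : ℝ) • z)
  simp only [smul_eq_mul, inner_add_left, inner_smul_left, conj_trivial] at h2 h3
  linarith

/-- The polar gradient of `Pf` at `y` is the point where the supremum defining `Pf(y)` is
attained. -/
lemma mem_polarSubdiff_polarT_iff (hf : S2 f) {x y : Euc n} :
    x ∈ polarSubdiff (polarT f) y ↔ (polarT f y).toReal * (f x).toReal = ⟪x, y⟫ - 1 := by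
  have hreal : ∀ z ≠ 0, ((polarT (polarT f) z : EReal) * (polarT f y : EReal) =
      ((⟪y, z⟫ - 1 : ℝ) : EReal) ↔ (polarT f y).toReal * (f z).toReal = ⟪z, y⟫ - 1) := by
    intro z hz
    rw [hf.polarT_polarT hz, ← EReal.coe_ennreal_toReal (hf.ne_top z),
      ← EReal.coe_ennreal_toReal (hf.polarT_ne_top y), ← EReal.coe_mul, EReal.coe_eq_coe_iff,
      mul_comm, real_inner_comm]
  constructor
  · rintro ⟨-, h⟩
    refine (hreal x ?_).1 h
    rintro rfl
    have h1 : (0 : EReal) ≤ (polarT (polarT f) 0 : EReal) * (polarT f y : EReal) := by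
      rw [← EReal.coe_ennreal_mul]; exact EReal.coe_ennreal_nonneg _
    rw [h] at h1
    have h2 : (0 : ℝ) ≤ ⟪y, (0 : Euc n)⟫ - 1 := by exact_mod_cast h1
    norm_num at h2
  · intro h
    have hx := ne_zero_of_polarT_mul_eq h
    exact ⟨by rw [hf.polarT_polarT hx]; exact hf.ne_top x, (hreal x hx).2 h⟩

end S2

end Polarity

/-- If the supremum defining `P(u t)(y)` is attained at `x₀`, then for `s` near `t` the supremum
defining `P(u s)(y)` is attained near `x₀`. -/
lemma eventually_exists_polarT_mul_eq {n : ℕ} (u : ℝ → Euc n → ℝ≥0∞) (hu : ∀ t, S2 (u t))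
    (hC : ∀ s, ∀ x ≠ 0, ContDiffAt ℝ 2 (fun p : ℝ × Euc n => (u p.1 p.2).toReal) (s, x))
    {t : ℝ} {x₀ y : Euc n} (hy : y ≠ 0)
    (hx₀ : (polarT (u t) y).toReal * (u t x₀).toReal = ⟪x₀, y⟫ - 1) {ε : ℝ} (hε : 0 < ε) :
    ∀ᶠ s in 𝓝 t, ∃ x, dist x x₀ < ε ∧
      (polarT (u s) y).toReal * (u s x).toReal = ⟪x, y⟫ - 1 := by
  have hx₀0 := S2.ne_zero_of_polarT_mul_eq hx₀
  obtain ⟨r, hr, hrlt⟩ := exists_between (lt_min hε (norm_pos_iff.2 hx₀0))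
  have hrε : r < ε := hrlt.trans_le (min_le_left _ _)
  have hrx : r < ‖x₀‖ := hrlt.trans_le (min_le_right _ _)
  have hB0 : ∀ x ∈ Metric.closedBall x₀ r, x ≠ 0 := by
    rintro x hx rfl
    rw [Metric.mem_closedBall, dist_zero_left] at hx
    linarith
  set W := (polarT (u t) y).toReal with hW
  have hWpos : 0 < W := (hu t).polarT_toReal_pos hy
  have hcont : ∀ (c s : ℝ), ∀ x ≠ 0, ContinuousAt
      (fun q : (ℝ × ℝ) × Euc n => q.1.1 * (u q.1.2 q.2).toReal - ⟪q.2, y⟫ + 1) ((c, s), x) := by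
    intro c s x hx
    have h1 : ContinuousAt (fun q : (ℝ × ℝ) × Euc n => (u q.1.2 q.2).toReal) ((c, s), x) :=
      ContinuousAt.comp (f := fun q : (ℝ × ℝ) × Euc n => (q.1.2, q.2))
        (g := fun p : ℝ × Euc n => (u p.1 p.2).toReal) (hC s x hx).continuousAt (by fun_prop)
    exact ((ContinuousAt.mul (by fun_prop) h1).sub (by fun_prop)).add continuousAt_const
  have hsphere : ∀ᶠ p : ℝ × ℝ in 𝓝 (W, t), ∀ x ∈ Metric.sphere x₀ r,
      0 < p.1 * (u p.2 x).toReal - ⟪x, y⟫ + 1 := by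
    refine (isCompact_sphere x₀ r).eventually_forall_of_forall_eventually
      (P := fun (p : ℝ × ℝ) x => 0 < p.1 * (u p.2 x).toReal - ⟪x, y⟫ + 1) fun x hx => ?_
    refine (hcont W t x (hB0 x (Metric.sphere_subset_closedBall hx))).eventually
      (lt_mem_nhds ?_)
    have hle := inner_le_one_add (hu t).ne_top ((hu t).polarT_ne_top y) x
    have hne : W * (u t x).toReal ≠ ⟪x, y⟫ - 1 := fun h => by
      have := (hu t).eq_of_polarT_mul_eq hy h hx₀
      rw [this, Metric.mem_sphere, dist_self] at hx
      exact hr.ne hx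
    have := lt_of_le_of_ne (sub_le_iff_le_add'.2 hle) hne.symm
    dsimp only
    linarith
  have hev : ∀ᶠ c in 𝓝[<] W, 0 < c ∧ c < W ∧ ∀ᶠ s in 𝓝 t, ∀ x ∈ Metric.sphere x₀ r,
      0 < c * (u s x).toReal - ⟪x, y⟫ + 1 := by
    filter_upwards [self_mem_nhdsWithin, nhdsWithin_le_nhds hsphere.curry_nhds,
      nhdsWithin_le_nhds (lt_mem_nhds hWpos)] with c h1 h2 h3
    exact ⟨h3, h1, h2⟩
  obtain ⟨c, hc0, hcW, hcS⟩ := hev.exists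
  have hcx₀ : ∀ᶠ s in 𝓝 t, c * (u s x₀).toReal - ⟪x₀, y⟫ + 1 < 0 := by
    have h1 : ContinuousAt (fun s => c * (u s x₀).toReal - ⟪x₀, y⟫ + 1) t :=
      ContinuousAt.comp (f := fun s : ℝ => ((c, s), x₀)) (hcont c t x₀ hx₀0) (by fun_prop)
    refine h1.eventually (gt_mem_nhds ?_)
    have := mul_lt_mul_of_pos_right hcW ((hu t).toReal_pos hx₀0)
    linarith
  filter_upwards [hcS, hcx₀] with s hS hneg
  have hpos : ∀ x ∈ Metric.closedBall x₀ r, 0 < (u s x).toReal :=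
    fun x hx => (hu s).toReal_pos (hB0 x hx)
  have hcB : ContinuousOn (fun x => (⟪x, y⟫ - 1) / (u s x).toReal) (Metric.closedBall x₀ r) :=
    ContinuousOn.div (by fun_prop) ((hu s).continuousOn.mono hB0) fun x hx => (hpos x hx).ne'
  have hx₀B : x₀ ∈ Metric.closedBall x₀ r := Metric.mem_closedBall_self hr.le
  obtain ⟨x, hxB, hmax⟩ := (isCompact_closedBall x₀ r).exists_isMaxOn ⟨x₀, hx₀B⟩ hcB
  refine ⟨x, (Metric.mem_closedBall.1 hxB).trans_lt hrε, le_antisymm ?_ ?_⟩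
  · rw [← le_div_iff₀ (hpos x hxB)]
    have hcM : c ≤ (⟪x, y⟫ - 1) / (u s x).toReal := by
      refine le_trans ?_ (hmax hx₀B)
      rw [le_div_iff₀ (hpos x₀ hx₀B)]
      linarith
    refine polarT_toReal_le (hu s).ne_top (hc0.le.trans hcM) fun z => ?_
    rcases le_total (dist z x₀) r with hz | hz
    · have h2 := (div_le_iff₀ (hpos z hz)).1 (hmax hz)
      linarith
    · have h1 := ((hu s).convexOn_mul_sub_inner y hc0.le).pos_of_pos_on_sphere hr hneg.le hS hz
      have h2 := mul_le_mul_of_nonneg_right hcM (ENNReal.toReal_nonneg (a := u s z))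
      linarith
  · linarith [inner_le_one_add (hu s).ne_top ((hu s).polarT_ne_top y) x]

/-- Proposition 5.2 (first variation of polarity): with `w(t,·) = P(u(t,·))`, at every `t` and
`y` with `w(t,·)` not linear on `[0,y]`, `∂ₜ log w(t,y) = - ∂ₜ log u(t, ∇°w(t,·)(y))`. -/
theorem stmt_12 {n : ℕ} (u : ℝ → Euc n → ℝ≥0∞) (hu : ∀ t : ℝ, S2 (u t))
    (hC2 : ContDiffOn ℝ 2 (fun p : ℝ × Euc n => (u p.1 p.2).toReal)
      {p : ℝ × Euc n | p.2 ≠ 0})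
    (t : ℝ) (y : Euc n) (hy : y ≠ 0)
    (hlin : ¬ RayLinear (polarT (u t)) y) :
    ∃ x : Euc n, polarSubdiff (polarT (u t)) y = {x} ∧
      deriv (fun s => Real.log ((polarT (u s) y).toReal)) t
        = - deriv (fun s => Real.log ((u s x).toReal)) t := by
  have hjoint : ∀ s, ∀ x ≠ 0, ContDiffAt ℝ 2 (fun p : ℝ × Euc n => (u p.1 p.2).toReal) (s, x) :=
    fun s x hx => hC2.contDiffAt
      ((isOpen_ne_fun continuous_snd continuous_const).mem_nhds (by simpa using hx))
  obtain ⟨x₀, hx₀⟩ := (hu t).exists_polarT_mul_eq hlin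
  have hx₀0 := S2.ne_zero_of_polarT_mul_eq hx₀
  refine ⟨x₀, ?_, ?_⟩
  · ext x
    rw [(hu t).mem_polarSubdiff_polarT_iff, mem_singleton_iff]
    exact ⟨fun h => (hu t).eq_of_polarT_mul_eq hy h hx₀, fun h => h ▸ hx₀⟩
  have hlogC : ContDiffAt ℝ 2 (fun p : ℝ × Euc n => Real.log (u p.1 p.2).toReal) (t, x₀) :=
    (hjoint t x₀ hx₀0).log ((hu t).toReal_pos hx₀0).ne'
  have hstrict := hlogC.hasStrictFDerivAt (by norm_num)
  have hright := hstrict.hasFDerivAt.comp_hasDerivAt t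
    ((hasDerivAt_id t).prodMk (hasDerivAt_const t x₀))
  have hL := hasDerivAt_of_envelope (L := fun s => Real.log (polarT (u s) y).toReal) hstrict
    ?_ ?_
  · rw [hL.deriv]
    exact congrArg Neg.neg hright.deriv.symm
  · have hpos := (hu t).polarT_toReal_pos hy
    have hinner : 0 < ⟪x₀, y⟫ - 1 := hx₀ ▸ mul_pos hpos ((hu t).toReal_pos hx₀0)
    refine Filter.Eventually.of_forall fun s => ?_
    have hle := inner_le_one_add (hu s).ne_top ((hu s).polarT_ne_top y) x₀
    have h1 := Real.log_le_log hinner (sub_le_iff_le_add'.2 hle)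
    have h2 := congrArg Real.log hx₀
    rw [Real.log_mul ((hu s).polarT_toReal_pos hy).ne' ((hu s).toReal_pos hx₀0).ne'] at h1
    rw [Real.log_mul hpos.ne' ((hu t).toReal_pos hx₀0).ne'] at h2
    linarith
  · intro ε hε
    filter_upwards [eventually_exists_polarT_mul_eq u hu hjoint hy hx₀ hε] with s ⟨x, hxε, hx⟩
    refine ⟨x, hxε, ?_⟩
    have hx0 := S2.ne_zero_of_polarT_mul_eq hx
    have hpos := (hu s).polarT_toReal_pos hy
    have hinner : 0 < ⟪x, y⟫ - 1 := hx ▸ mul_pos hpos ((hu s).toReal_pos hx0)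
    have hle := inner_le_one_add (hu t).ne_top ((hu t).polarT_ne_top y) x
    have h1 := Real.log_le_log hinner (sub_le_iff_le_add'.2 hle)
    have h2 := congrArg Real.log hx
    rw [Real.log_mul ((hu t).polarT_toReal_pos hy).ne' ((hu t).toReal_pos hx0).ne'] at h1
    rw [Real.log_mul hpos.ne' ((hu s).toReal_pos hx0).ne'] at h2
    linarith
end
end

section
/- (Homogeneous polar Monge–Ampère, Dirichlet problem.) Let u₀, u_T ∈ S₂(ℝⁿ) be nonlinear at infinity, and let T > 0. The Dirichlet problem ∂²/∂t²(1/u) + |∇(u̇/u)|²_{(∇²u)⁻¹} = 0 on (0,T) × (ℝⁿ∖{0}), with u(0,·) = u₀ and u(T,·) = u_T, admits a unique solution u with u(t,·) ∈ S₂(ℝⁿ) nonlinear at infinity for each t ∈ [0,T], given by u(t,·) = P( (1 − t/T)·P(u₀) + (t/T)·P(u_T) ). Here u̇ = ∂u/∂t, ∇ and ∇² denote spatial gradient and Hessian, and |X|²_g := ⟨X, gX⟩. -/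
open scoped ENNReal RealInnerProductSpace
open Set

noncomputable section

/-- `u` solves the homogeneous polar Monge–Ampère equation
`∂ₜ²(1/u) + |∇(u̇/u)|²_{(∇²u)⁻¹} = 0` on `(0,T) × (ℝⁿ∖{0})` with boundary data `u₀, u_T`,
with `u(t,·) ∈ S₂` nonlinear at infinity for `t ∈ [0,T]`. The vector `q` with
`∇²u(t,·)(x) q = ∇(u̇/u)(t,x)` realizes the inverse Hessian. -/
def IsSolutionHPMA {n : ℕ} (T : ℝ) (u₀ uT : Euc n → ℝ≥0∞)
    (u : ℝ → Euc n → ℝ≥0∞) : Prop :=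
  (∀ t ∈ Icc (0:ℝ) T, S2 (u t) ∧ NonlinearAtInfinity (u t)) ∧
  u 0 = u₀ ∧ u T = uT ∧
  ContDiffOn ℝ 2 (fun p : ℝ × Euc n => (u p.1 p.2).toReal)
    {p : ℝ × Euc n | p.1 ∈ Icc (0:ℝ) T ∧ p.2 ≠ 0} ∧
  ∀ t ∈ Ioo (0:ℝ) T, ∀ x : Euc n, x ≠ 0 →
    ∃ q : Euc n,
      hess (fun z => (u t z).toReal) x q
        = gradient (fun z => deriv (fun s => (u s z).toReal) t / (u t z).toReal) x ∧
      deriv (fun s => deriv (fun r => ((u r x).toReal)⁻¹) s) t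
        + ⟪gradient (fun z => deriv (fun s => (u s z).toReal) t / (u t z).toReal) x, q⟫
          = 0

open scoped Topology
open Filter

namespace PolarMongeAmpere

variable {n : ℕ}

/-- Real-valued counterpart of the conditions `S2` and `NonlinearAtInfinity`. -/
structure Admissible (f : Euc n → ℝ) : Prop where
  zero : f 0 = 0
  nonneg : ∀ x, 0 ≤ f x
  strictConvex : StrictConvexOn ℝ univ f
  contDiffOn : ContDiffOn ℝ 2 f {0}ᶜ
  hess_pos : ∀ x, x ≠ 0 → ∀ v, v ≠ 0 → 0 < ⟪v, hess f x v⟫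
  nonlinear : ∀ x, x ≠ 0 → ¬ ∃ a b : ℝ, 0 ≤ a ∧ 0 < b ∧ ∀ t : ℝ, 0 ≤ t →
    a * t - b ≤ f (t • x) ∧ f (t • x) ≤ a * t

/-- `x` is the polar dual point of `y`, with `c` the value of the polar transform of `f` at `y`. -/
structure PolarDual (f : Euc n → ℝ) (x y : Euc n) (c : ℝ) : Prop where
  ne : x ≠ 0
  pos : 0 < c
  eq : c * f x = ⟪x, y⟫ - 1
  le : ∀ z, ⟪z, y⟫ ≤ 1 + c * f z

namespace Admissible

variable {f : Euc n → ℝ}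

theorem convex (hf : Admissible f) : ConvexOn ℝ univ f := hf.strictConvex.convexOn

theorem smul_le (hf : Admissible f) {s : ℝ} (h0 : 0 ≤ s) (h1 : s ≤ 1) (x : Euc n) :
    f (s • x) ≤ s * f x := by
  have := hf.convex.2 (mem_univ x) (mem_univ 0) h0 (sub_nonneg.2 h1) (by ring)
  simpa [hf.zero] using this

theorem smul_lt (hf : Admissible f) {s : ℝ} (h0 : 0 < s) (h1 : s < 1) {x : Euc n} (hx : x ≠ 0) :
    f (s • x) < s * f x := by
  have := hf.strictConvex.2 (mem_univ x) (mem_univ 0) hx h0 (sub_pos.2 h1) (by ring)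
  simpa [hf.zero] using this

theorem pos (hf : Admissible f) {x : Euc n} (hx : x ≠ 0) : 0 < f x := by
  have h1 := hf.smul_lt (s := 1 / 2) (by norm_num) (by norm_num) hx
  have h2 := hf.nonneg ((1 / 2 : ℝ) • x)
  linarith

theorem continuous (hf : Admissible f) : Continuous f :=
  hf.convex.locallyLipschitz.continuous

theorem contDiffAt (hf : Admissible f) {x : Euc n} (hx : x ≠ 0) : ContDiffAt ℝ 2 f x :=
  hf.contDiffOn.contDiffAt (isOpen_compl_singleton.mem_nhds hx)

theorem differentiableAt (hf : Admissible f) {x : Euc n} (hx : x ≠ 0) : DifferentiableAt ℝ f x :=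
  (hf.contDiffAt hx).differentiableAt (by norm_num)

/-- A bound by a positively homogeneous function on a sphere propagates outwards. -/
theorem le_of_le_on_sphere (hf : Admissible f) {ψ : Euc n → ℝ}
    (hψ : ∀ s : ℝ, 0 ≤ s → ∀ z, ψ (s • z) = s * ψ z) {c R : ℝ} (hc : 0 ≤ c) (hR : 0 < R)
    (h : ∀ z, ‖z‖ = R → ψ z ≤ c * f z) : ∀ z, R ≤ ‖z‖ → ψ z ≤ c * f z := by
  intro z hz
  have hz0 : 0 < ‖z‖ := hR.trans_le hz
  have hs : 0 < R / ‖z‖ := div_pos hR hz0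
  have h1 := h ((R / ‖z‖) • z) (by
    rw [norm_smul, Real.norm_of_nonneg hs.le]; field_simp)
  rw [hψ _ hs.le] at h1
  have h2 := hf.smul_le hs.le ((div_le_one hz0).2 hz) z
  have h3 : R / ‖z‖ * ψ z ≤ R / ‖z‖ * (c * f z) := by nlinarith
  exact le_of_mul_le_mul_left h3 hs

theorem exists_mul_norm_le (hf : Admissible f) {r : ℝ} (hr : 0 < r) :
    ∃ C : ℝ, 0 < C ∧ ∀ z, r ≤ ‖z‖ → ‖z‖ ≤ C * f z := by
  obtain ⟨m, hm, hm'⟩ := (isCompact_sphere (0 : Euc n) r).exists_forall_le'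
    hf.continuous.continuousOn (a := 0) (fun b hb => hf.pos (by
      rintro rfl
      simp at hb
      exact hr.ne hb))
  refine ⟨r / m, div_pos hr hm, hf.le_of_le_on_sphere (ψ := fun z => ‖z‖) ?_ (by positivity) hr ?_⟩
  · intro s hs z
    rw [norm_smul, Real.norm_of_nonneg hs]
  · intro z hz
    have := hm' z (by simpa using hz)
    rw [hz, div_mul_eq_mul_div, le_div_iff₀ hm]
    exact mul_le_mul_of_nonneg_left this hr.le

theorem gradient_ineq (hf : Admissible f) {x : Euc n} (hx : x ≠ 0) (z : Euc n) :
    f x + ⟪gradient f x, z - x⟫ ≤ f z := by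
  have hd : HasDerivAt (fun t : ℝ => f (x + t • (z - x))) (⟪gradient f x, z - x⟫) 0 := by
    have h1 : HasDerivAt (fun t : ℝ => x + t • (z - x)) (z - x) 0 := by
      simpa using ((hasDerivAt_id (0 : ℝ)).smul_const (z - x)).const_add x
    have h2 : HasFDerivAt f (fderiv ℝ f x) (x + (0 : ℝ) • (z - x)) := by
      simpa using (hf.differentiableAt hx).hasFDerivAt
    have := h2.comp_hasDerivAt (0 : ℝ) h1
    rwa [← inner_gradient_left] at this
  have hc : ConvexOn ℝ univ (fun t : ℝ => f (x + t • (z - x))) := by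
    refine ⟨convex_univ, fun s _ t _ a b ha hb hab => ?_⟩
    have := hf.convex.2 (mem_univ (x + s • (z - x))) (mem_univ (x + t • (z - x))) ha hb hab
    convert this using 2
    simp only [smul_add, smul_smul, add_smul, smul_eq_mul]
    have : x = a • x + b • x := by rw [← add_smul, hab, one_smul]
    nth_rewrite 1 [this]
    abel
  have := hc.le_slope_of_hasDerivAt (mem_univ 0) (mem_univ 1) one_pos hd
  simp only [slope_def_field, zero_smul, one_smul, add_zero, add_sub_cancel, sub_zero,
    div_one] at this
  linarith

theorem lt_inner_gradient (hf : Admissible f) {x : Euc n} (hx : x ≠ 0) :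
    f x < ⟪x, gradient f x⟫ := by
  have h1 := hf.gradient_ineq hx ((1 / 2 : ℝ) • x)
  have h2 := hf.smul_lt (s := 1 / 2) (by norm_num) (by norm_num) hx
  have h3 : (1 / 2 : ℝ) • x - x = -((1 / 2 : ℝ) • x) := by
    module
  rw [h3, inner_neg_right, inner_smul_right, real_inner_comm] at h1
  linarith

theorem polarDual_of_gradient (hf : Admissible f) {x y : Euc n} {c : ℝ} (hx : x ≠ 0)
    (h1 : c • gradient f x = y) (h2 : c * (⟪x, gradient f x⟫ - f x) = 1) : PolarDual f x y c := by
  have hc : 0 < c := by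
    have := sub_pos.2 (hf.lt_inner_gradient hx)
    by_contra! h
    nlinarith
  refine ⟨hx, hc, ?_, fun z => ?_⟩
  · rw [← h1, inner_smul_right]; linarith
  · have := mul_le_mul_of_nonneg_left (hf.gradient_ineq hx z) hc.le
    rw [inner_sub_right, real_inner_comm, real_inner_comm x] at this
    rw [← h1, inner_smul_right]
    linarith

theorem exists_polarDual_of_ne (hf : Admissible f) {x : Euc n} (hx : x ≠ 0) :
    ∃ y c, y ≠ 0 ∧ PolarDual f x y c := by
  have hD := sub_pos.2 (hf.lt_inner_gradient hx)
  have h := hf.polarDual_of_gradient (c := (⟪x, gradient f x⟫ - f x)⁻¹) hx rfl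
    (inv_mul_cancel₀ hD.ne')
  refine ⟨_, _, fun h0 => ?_, h⟩
  have h1 := h.eq
  rw [h0, inner_zero_right] at h1
  have := mul_pos h.pos (hf.pos hx)
  linarith

end Admissible

namespace PolarDual

variable {f : Euc n → ℝ} {x y : Euc n} {c : ℝ}

theorem gradient_eq (h : PolarDual f x y c) (hf : Admissible f) : c • gradient f x = y := by
  have hmin : IsLocalMin (fun z => c * f z - ⟪y, z⟫) x := by
    refine Filter.Eventually.of_forall fun z => ?_
    have h1 := h.le z
    have h2 := h.eq
    simp only [real_inner_comm] at *
    linarith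
  have hd := ((hf.differentiableAt h.ne).hasFDerivAt.const_mul c).sub
    ((innerSL ℝ y).hasFDerivAt (x := x))
  have h0 := hmin.hasFDerivAt_eq_zero hd
  refine ext_inner_right ℝ fun v => ?_
  have := congrArg (fun l => l v) h0
  simp at this
  rw [real_inner_smul_left, inner_gradient_left]
  linarith

theorem mul_sub_eq_one (h : PolarDual f x y c) (hf : Admissible f) :
    c * (⟪x, gradient f x⟫ - f x) = 1 := by
  have h1 := h.eq
  rw [← h.gradient_eq hf, inner_smul_right] at h1
  linarith

theorem symm_ne (h : PolarDual f x y c) (hf : Admissible f) : y ≠ 0 := by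
  rintro rfl
  have h1 := h.eq
  rw [inner_zero_right] at h1
  have := mul_pos h.pos (hf.pos h.ne)
  linarith

end PolarDual

namespace Admissible

variable {f : Euc n → ℝ}

theorem exists_polarDual (hf : Admissible f) {y : Euc n} (hy : y ≠ 0) :
    ∃ x c, PolarDual f x y c := by
  have hy0 : 0 < ‖y‖ := norm_pos_iff.2 hy
  set r : ℝ := ‖y‖⁻¹ with hr
  have hr0 : 0 < r := inv_pos.2 hy0
  have hin : ∀ z : Euc n, ⟪z, y⟫ ≤ ‖z‖ * ‖y‖ := fun z => real_inner_le_norm z y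
  have hsmall : ∀ z : Euc n, ‖z‖ < r → ⟪z, y⟫ ≤ 1 := fun z hz => by
    have : ‖z‖ * ‖y‖ ≤ r * ‖y‖ := by gcongr
    rw [hr, inv_mul_cancel₀ hy0.ne'] at this
    exact (hin z).trans this
  let S : Set ℝ := {c | 0 ≤ c ∧ ∀ z, ⟪z, y⟫ ≤ 1 + c * f z}
  have hSbdd : BddBelow S := ⟨0, fun c hc => hc.1⟩
  have hSne : S.Nonempty := by
    obtain ⟨C, hC, hC'⟩ := hf.exists_mul_norm_le hr0
    refine ⟨C * ‖y‖, by positivity, fun z => ?_⟩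
    rcases lt_or_ge ‖z‖ r with h | h
    · have := hsmall z h
      have h2 := hf.nonneg z
      have : 0 ≤ C * ‖y‖ * f z := by positivity
      linarith
    · have := mul_le_mul_of_nonneg_right (hC' z h) hy0.le
      have := hin z
      linarith
  have hSclosed : IsClosed S := by
    have : S = Ici 0 ∩ ⋂ z, {c : ℝ | ⟪z, y⟫ ≤ 1 + c * f z} := by
      ext c; simp [S]
    rw [this]
    exact isClosed_Ici.inter (isClosed_iInter fun z => isClosed_le continuous_const (by fun_prop))
  set c := sInf S with hc
  have hcS : c ∈ S := hSclosed.csInf_mem hSne hSbdd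
  have hcpos : 0 < c := by
    refine lt_of_le_of_ne hcS.1 fun h0 => ?_
    have := hcS.2 ((2 / ‖y‖ ^ 2) • y)
    rw [← h0, real_inner_smul_left, real_inner_self_eq_norm_sq, div_mul_cancel₀ _ (by positivity)]
      at this
    norm_num at this
  suffices h : ∃ x, c * f x = ⟪x, y⟫ - 1 by
    obtain ⟨x, hx⟩ := h
    refine ⟨x, c, ?_, hcpos, hx, hcS.2⟩
    rintro rfl
    rw [hf.zero, inner_zero_left] at hx
    norm_num at hx
  by_contra! hne
  have hlt : ∀ z, ⟪z, y⟫ - 1 < c * f z := fun z =>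
    lt_of_le_of_ne (by linarith [hcS.2 z]) (hne z).symm
  by_cases hR : ∃ R : ℝ, 0 < R ∧ ∀ z, ‖z‖ = R → ⟪z, y⟫ < c * f z
  · obtain ⟨R, hR0, hR⟩ := hR
    have hq : ∀ g : Euc n → ℝ, Continuous g → ∀ K : Set (Euc n), IsCompact K →
        (∀ z ∈ K, z ≠ 0) → (∀ z ∈ K, g z < c * f z) →
        ∃ c' < c, ∀ z ∈ K, g z ≤ c' * f z := by
      intro g hg K hK hK0 hlt
      obtain ⟨e, he, he'⟩ := hK.exists_forall_le' (f := fun z => c - g z / f z) (a := 0)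
        (continuousOn_const.sub (hg.continuousOn.div hf.continuous.continuousOn
          fun z hz => (hf.pos (hK0 z hz)).ne')) (fun z hz => by
          rw [sub_pos, div_lt_iff₀ (hf.pos (hK0 z hz))]; exact hlt z hz)
      refine ⟨c - e, by linarith, fun z hz => ?_⟩
      rw [← div_le_iff₀ (hf.pos (hK0 z hz))]
      linarith [he' z hz]
    obtain ⟨c1, hc1, hc1'⟩ := hq (fun z => ⟪z, y⟫) (by fun_prop) (Metric.sphere 0 R)
      (isCompact_sphere _ _) (fun z hz => by
        rintro rfl
        simp at hz
        exact hR0.ne hz) (fun z hz => hR z (by simpa using hz))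
    obtain ⟨c2, hc2, hc2'⟩ := hq (fun z => ⟪z, y⟫ - 1) (by fun_prop)
      (Metric.closedBall 0 R ∩ {z | r ≤ ‖z‖})
      ((isCompact_closedBall _ _).inter_right (isClosed_le continuous_const continuous_norm))
      (fun z hz => by
        rintro rfl
        have := hz.2
        simp at this
        linarith) (fun z _ => hlt z)
    set c' := max (max c1 c2) 0 with hc'
    have hc'c : c' < c := by simp [hc', hc1, hc2, hcpos]
    have h1 : c1 ≤ c' := le_trans (le_max_left _ _) (le_max_left _ _)
    have h2 : c2 ≤ c' := le_trans (le_max_right _ _) (le_max_left _ _)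
    have h0 : 0 ≤ c' := le_max_right _ _
    have : c' ∈ S := by
      refine ⟨h0, fun z => ?_⟩
      have hz0 := hf.nonneg z
      rcases lt_or_ge ‖z‖ r with h | h
      · have := hsmall z h
        nlinarith
      rcases le_or_gt ‖z‖ R with h' | h'
      · have := hc2' z ⟨by simpa using h', h⟩
        nlinarith
      · have := hf.le_of_le_on_sphere (ψ := fun z => ⟪z, y⟫)
          (fun s _ z => real_inner_smul_left _ _ _) h0 hR0
          (fun z hz => (hc1' z (by simpa using hz)).trans
            (mul_le_mul_of_nonneg_right h1 (hf.nonneg z))) z h'.le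
        linarith
    exact absurd (csInf_le hSbdd this) (not_le.2 hc'c)
  · push Not at hR
    let t : ℕ → Set (Euc n) := fun k =>
      Metric.sphere 0 1 ∩ {z | c * f (((k : ℝ) + 1) • z) ≤ ((k : ℝ) + 1) * ⟪z, y⟫}
    have hmono : ∀ {s s' : ℝ}, 0 < s → s ≤ s' → ∀ z : Euc n,
        c * f (s' • z) ≤ s' * ⟪z, y⟫ → c * f (s • z) ≤ s * ⟪z, y⟫ := by
      intro s s' hs hss z hz
      have hs' : 0 < s' := hs.trans_le hss
      have h1 := hf.smul_le (s := s / s') (by positivity) ((div_le_one hs').2 hss) (s' • z)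
      rw [smul_smul, div_mul_cancel₀ _ hs'.ne'] at h1
      calc c * f (s • z) ≤ c * (s / s' * f (s' • z)) := by gcongr
        _ = s / s' * (c * f (s' • z)) := by ring
        _ ≤ s / s' * (s' * ⟪z, y⟫) := by gcongr
        _ = s * ⟪z, y⟫ := by field_simp
    have htclosed : ∀ k, IsClosed (t k) := fun k =>
      Metric.isClosed_sphere.inter (isClosed_le
        (continuous_const.mul (hf.continuous.comp (by fun_prop))) (by fun_prop))
    obtain ⟨θ, hθ⟩ := IsCompact.nonempty_iInter_of_sequence_nonempty_isCompact_isClosed t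
      (fun k z hz => ⟨hz.1, hmono (by positivity) (by push_cast; linarith) z hz.2⟩)
      (fun k => by
        have hk : (0 : ℝ) < (k : ℝ) + 1 := by positivity
        obtain ⟨z, hz, hz'⟩ := hR _ hk
        refine ⟨((k : ℝ) + 1)⁻¹ • z, ?_, ?_⟩
        · simp [norm_smul, hz, abs_of_pos hk, hk.ne']
        · simp only [mem_ofPred_eq]
          rw [smul_smul, mul_inv_cancel₀ hk.ne', one_smul, real_inner_smul_left, ← mul_assoc,
            mul_inv_cancel₀ hk.ne', one_mul]
          exact hz')
      ((isCompact_sphere _ _).of_isClosed_subset (htclosed 0) inter_subset_left) htclosed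
    rw [mem_iInter] at hθ
    have hθ0 : θ ≠ 0 := by
      rintro rfl
      have := (hθ 0).1
      simp at this
    have hall : ∀ s : ℝ, 0 ≤ s → c * f (s • θ) ≤ s * ⟪θ, y⟫ := by
      intro s hs
      rcases hs.eq_or_lt with rfl | hs
      · simp [hf.zero]
      obtain ⟨k, hk⟩ := exists_nat_ge s
      exact hmono hs (by linarith) θ (hθ k).2
    refine hf.nonlinear θ hθ0 ⟨⟪θ, y⟫ / c, 1 / c, ?_, by positivity, fun s hs => ⟨?_, ?_⟩⟩
    · have h1 := hall 1 zero_le_one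
      have h2 := mul_nonneg hcpos.le (hf.nonneg ((1 : ℝ) • θ))
      exact div_nonneg (by linarith) hcpos.le
    · have := hlt (s • θ)
      rw [real_inner_smul_left] at this
      rw [div_mul_eq_mul_div, ← sub_div, div_le_iff₀ hcpos]
      linarith
    · rw [div_mul_eq_mul_div, le_div_iff₀ hcpos]
      linarith [hall s hs]

end Admissible

section SpaceTime

variable {W : ℝ × Euc n → ℝ} {p : ℝ × Euc n}

/-- The gradient in the space variable of a function on space-time. -/
def spaceGrad (W : ℝ × Euc n → ℝ) (p : ℝ × Euc n) : Euc n := gradient (fun z => W (p.1, z)) p.2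

/-- The time derivative of a function on space-time. -/
def timeDeriv (W : ℝ × Euc n → ℝ) (p : ℝ × Euc n) : ℝ := fderiv ℝ W p (1, 0)

/-- The Legendre expression `⟨x, ∇W⟩ - W`. -/
def legendreExpr (W : ℝ × Euc n → ℝ) (p : ℝ × Euc n) : ℝ := ⟪p.2, spaceGrad W p⟫ - W p

theorem inner_spaceGrad (hW : DifferentiableAt ℝ W p) (v : Euc n) :
    ⟪spaceGrad W p, v⟫ = fderiv ℝ W p (0, v) := by
  have h := hW.hasFDerivAt.comp (f := fun z : Euc n => (p.1, z)) p.2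
    (hasFDerivAt_prodMk_right p.1 p.2)
  rw [spaceGrad, inner_gradient_left]
  have h' : fderiv ℝ (fun z => W (p.1, z)) p.2 = _ := h.fderiv
  rw [h']
  simp

theorem fderiv_eq (hW : DifferentiableAt ℝ W p) (w : ℝ × Euc n) :
    fderiv ℝ W p w = w.1 * timeDeriv W p + ⟪spaceGrad W p, w.2⟫ := by
  rw [inner_spaceGrad hW, timeDeriv, ← smul_eq_mul, ← map_smul, ← map_add]
  simp

theorem hasDerivAt_time {F : Type*} [NormedAddCommGroup F] [NormedSpace ℝ F]
    {V : ℝ × Euc n → F} (hV : DifferentiableAt ℝ V p) :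
    HasDerivAt (fun t => V (t, p.2)) (fderiv ℝ V p (1, 0)) p.1 := by
  have h1 : HasDerivAt (fun t : ℝ => (t, p.2)) ((1 : ℝ), (0 : Euc n)) p.1 :=
    (hasDerivAt_id p.1).prodMk (hasDerivAt_const _ _)
  exact hV.hasFDerivAt.comp_hasDerivAt p.1 h1

theorem eventually_differentiableAt {F : Type*} [NormedAddCommGroup F] [NormedSpace ℝ F]
    {V : ℝ × Euc n → F} {k : ℕ} (hk : k ≠ 0) (hV : ContDiffAt ℝ k V p) :
    ∀ᶠ q in 𝓝 p, DifferentiableAt ℝ V q :=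
  (hV.eventually (by simp)).mono fun _ h => h.differentiableAt (by exact_mod_cast hk)

theorem contDiffAt_fderiv (hW : ContDiffAt ℝ 2 W p) : ContDiffAt ℝ 1 (fderiv ℝ W) p :=
  hW.fderiv_right (by norm_num)

theorem contDiffAt_timeDeriv (hW : ContDiffAt ℝ 2 W p) : ContDiffAt ℝ 1 (timeDeriv W) p :=
  (contDiffAt_fderiv hW).clm_apply contDiffAt_const

theorem contDiffAt_spaceGrad (hW : ContDiffAt ℝ 2 W p) : ContDiffAt ℝ 1 (spaceGrad W) p := by
  have h : ContDiffAt ℝ 1 (fun q => (InnerProductSpace.toDual ℝ (Euc n)).symm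
      ((fderiv ℝ W q).comp (ContinuousLinearMap.inr ℝ ℝ (Euc n)))) p :=
    (InnerProductSpace.toDual ℝ (Euc n)).symm.toContinuousLinearEquiv.contDiff.contDiffAt.comp p
      ((contDiffAt_fderiv hW).clm_comp contDiffAt_const)
  refine h.congr_of_eventuallyEq ?_
  filter_upwards [eventually_differentiableAt two_ne_zero hW] with q hq
  refine ext_inner_right ℝ fun v => ?_
  rw [inner_spaceGrad hq, InnerProductSpace.toDual_symm_apply]
  simp

theorem contDiffAt_legendreExpr (hW : ContDiffAt ℝ 2 W p) : ContDiffAt ℝ 1 (legendreExpr W) p :=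
  (contDiffAt_snd.inner ℝ (contDiffAt_spaceGrad hW)).sub (hW.of_le (by norm_num))

theorem hess_apply (hW : ContDiffAt ℝ 2 W p) (v : Euc n) :
    hess (fun z => W (p.1, z)) p.2 v = fderiv ℝ (spaceGrad W) p (0, v) := by
  have hG := (contDiffAt_spaceGrad hW).differentiableAt (by norm_num)
  have h := hG.hasFDerivAt.comp (f := fun z : Euc n => (p.1, z)) p.2
    (hasFDerivAt_prodMk_right p.1 p.2)
  have h' : fderiv ℝ (fun z => gradient (fun z => W (p.1, z)) z) p.2 = _ := h.fderiv
  rw [hess, h']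
  simp

theorem inner_fderiv_spaceGrad (hW : ContDiffAt ℝ 2 W p) (w : ℝ × Euc n) (v : Euc n) :
    ⟪fderiv ℝ (spaceGrad W) p w, v⟫ = fderiv ℝ (fderiv ℝ W) p w (0, v) := by
  have hG := (contDiffAt_spaceGrad hW).differentiableAt (by norm_num)
  have h1 := hG.hasFDerivAt.inner ℝ (hasFDerivAt_const v p)
  have h2 := ((contDiffAt_fderiv hW).differentiableAt (by norm_num)).hasFDerivAt.clm_apply
    (hasFDerivAt_const ((0 : ℝ), v) p)
  have h3 := h1.congr_of_eventuallyEq (f₁ := fun q => fderiv ℝ W q (0, v)) (by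
    filter_upwards [eventually_differentiableAt two_ne_zero hW] with q hq
    rw [inner_spaceGrad hq])
  have := congrArg (fun l => l w) (h3.unique h2)
  simpa using this

theorem fderiv_timeDeriv (hW : ContDiffAt ℝ 2 W p) (w : ℝ × Euc n) :
    fderiv ℝ (timeDeriv W) p w = fderiv ℝ (fderiv ℝ W) p w (1, 0) := by
  have h2 := ((contDiffAt_fderiv hW).differentiableAt (by norm_num)).hasFDerivAt.clm_apply
    (hasFDerivAt_const ((1 : ℝ), (0 : Euc n)) p)
  have h3 : fderiv ℝ (timeDeriv W) p = _ := h2.fderiv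
  simp [h3]

theorem fderiv_timeDeriv_space (hW : ContDiffAt ℝ 2 W p) (v : Euc n) :
    fderiv ℝ (timeDeriv W) p (0, v) = ⟪fderiv ℝ (spaceGrad W) p (1, 0), v⟫ := by
  rw [fderiv_timeDeriv hW, inner_fderiv_spaceGrad hW]
  exact hW.isSymmSndFDerivAt (by simp) _ _

end SpaceTime

/-- Near `(p.1, y)`, `U` is the polar transform of `W` in the space variable, and `X` the dual
point. -/
structure LocalPolar (W : ℝ × Euc n → ℝ) (p : ℝ × Euc n) (y : Euc n)
    (X : ℝ × Euc n → Euc n) (U : ℝ × Euc n → ℝ) : Prop where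
  apply : X (p.1, y) = p.2
  contDiffAt_point : ContDiffAt ℝ 1 X (p.1, y)
  contDiffAt : ContDiffAt ℝ 2 U (p.1, y)
  smul_spaceGrad : ∀ᶠ q in 𝓝 (p.1, y), U q • spaceGrad W (q.1, X q) = q.2
  mul_legendreExpr : ∀ᶠ q in 𝓝 (p.1, y), U q * legendreExpr W (q.1, X q) = 1
  hasFDerivAt : ∀ᶠ q in 𝓝 (p.1, y), HasFDerivAt U
    ((W (q.1, X q))⁻¹ • ((innerSL ℝ (X q)).comp (ContinuousLinearMap.snd ℝ ℝ (Euc n)) -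
      (U q * timeDeriv W (q.1, X q)) • ContinuousLinearMap.fst ℝ ℝ (Euc n))) q

theorem exists_localPolar {W : ℝ × Euc n → ℝ} {p : ℝ × Euc n} {y : Euc n}
    (hW : ContDiffAt ℝ 2 W p) (hW0 : W p ≠ 0) (hD : legendreExpr W p ≠ 0)
    (hH : ∀ v, v ≠ 0 → hess (fun z => W (p.1, z)) p.2 v ≠ 0)
    (hy : (legendreExpr W p)⁻¹ • spaceGrad W p = y) :
    ∃ X U, LocalPolar W p y X U := by
  let Φ : ℝ × Euc n → ℝ × Euc n := fun q => (q.1, (legendreExpr W q)⁻¹ • spaceGrad W q)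
  have hGc := contDiffAt_spaceGrad hW
  have hDc := contDiffAt_legendreExpr hW
  have hΦc : ContDiffAt ℝ 1 Φ p := contDiffAt_fst.prodMk ((hDc.inv hD).smul hGc)
  have hGd := (hGc.differentiableAt (by norm_num)).hasFDerivAt
  have hWd := (hW.differentiableAt (by norm_num))
  have hDd : HasFDerivAt (legendreExpr W) _ p :=
    (hasFDerivAt_snd.inner ℝ hGd).sub hWd.hasFDerivAt
  have hΦd : HasFDerivAt Φ _ p :=
    hasFDerivAt_fst.prodMk (((hasDerivAt_inv hD).comp_hasFDerivAt p hDd).smul hGd)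
  set Φ' := fderiv ℝ Φ p with hΦ'
  have hΦd' := hΦd.fderiv
  have hinj : Function.Injective Φ' := by
    rw [injective_iff_map_eq_zero]
    rintro ⟨s, v⟩ h0
    rw [hΦ', hΦd'] at h0
    simp only [ContinuousLinearMap.prod_apply, Prod.mk_eq_zero] at h0
    obtain ⟨hs, hv⟩ := h0
    replace hs : s = 0 := by simpa using hs
    subst hs
    set H := fderiv ℝ (spaceGrad W) p (0, v) with hHdef
    set D := legendreExpr W p with hDdef
    set a := ⟪p.2, H⟫ with ha
    have hv' : D⁻¹ • H - ((D ^ 2)⁻¹ * a) • spaceGrad W p = 0 := by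
      rw [← hv]
      have hc : ⟪v, spaceGrad W p⟫ = fderiv ℝ W p (0, v) := by
        rw [real_inner_comm, inner_spaceGrad hWd]
      simp [fderivInnerCLM_apply, hc, ← hHdef, ← ha, sub_eq_add_neg]
      rw [← hDdef, ← neg_smul]
      congr 2
      ring
    have h1 := congrArg (fun z => D ^ 2 * ⟪p.2, z⟫) hv'
    simp only [inner_sub_right, inner_smul_right, inner_zero_right, mul_zero, ← ha] at h1
    have h2 : a * W p = 0 := by
      have h3 : D = ⟪p.2, spaceGrad W p⟫ - W p := rfl
      have h4 : a * (D - ⟪p.2, spaceGrad W p⟫) = 0 := by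
        rw [← h1]; field_simp
      rw [h3] at h4
      linarith
    have ha0 : a = 0 := (mul_eq_zero.1 h2).resolve_right hW0
    rw [ha0, mul_zero, zero_smul, sub_zero, smul_eq_zero] at hv'
    have hH0 : H = 0 := hv'.resolve_left (inv_ne_zero hD)
    have : v = 0 := by
      by_contra hv0
      exact hH v hv0 (by rw [hess_apply hW]; exact hH0)
    simp [this]
  let e : (ℝ × Euc n) ≃L[ℝ] (ℝ × Euc n) :=
    (LinearEquiv.ofInjectiveEndo (Φ' : (ℝ × Euc n) →ₗ[ℝ] (ℝ × Euc n)) hinj).toContinuousLinearEquiv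
  have he : HasFDerivAt Φ (e : (ℝ × Euc n) →L[ℝ] (ℝ × Euc n)) p := by
    have : (e : (ℝ × Euc n) →L[ℝ] (ℝ × Euc n)) = Φ' := by ext1 <;> ext1 <;> rfl
    rw [this]
    exact (hΦc.differentiableAt (by norm_num)).hasFDerivAt
  have hΦp : Φ p = (p.1, y) := by simp [Φ, hy]
  set Ψ := hΦc.localInverse he (by norm_num) with hΨ
  have hΨp : Ψ (p.1, y) = p := by
    rw [← hΦp]; exact hΦc.localInverse_apply_image he (by norm_num)
  have hΨc : ContDiffAt ℝ 1 Ψ (p.1, y) := by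
    rw [← hΦp]; exact hΦc.to_localInverse he (by norm_num)
  have hright : ∀ᶠ q in 𝓝 (p.1, y), Φ (Ψ q) = q := by
    rw [← hΦp]
    exact (hΦc.hasStrictFDerivAt' he (by norm_num)).eventually_right_inverse
  have hΨt : Tendsto Ψ (𝓝 (p.1, y)) (𝓝 p) := by
    have := hΨc.continuousAt.tendsto
    rwa [hΨp] at this
  have hfst : ∀ᶠ q in 𝓝 (p.1, y), Ψ q = (q.1, (Ψ q).2) :=
    hright.mono fun q hq => by
      have h : (Φ (Ψ q)).1 = q.1 := by rw [hq]
      exact Prod.ext h rfl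
  let X : ℝ × Euc n → Euc n := fun q => (Ψ q).2
  let U : ℝ × Euc n → ℝ := fun q => (legendreExpr W (Ψ q))⁻¹
  have hXc : ContDiffAt ℝ 1 X (p.1, y) := hΨc.snd
  have hUc : ContDiffAt ℝ 1 U (p.1, y) := by
    refine ContDiffAt.inv (ContDiffAt.comp (g := legendreExpr W) (f := Ψ) (p.1, y) ?_ hΨc) ?_
    · rwa [hΨp]
    · rwa [hΨp]
  have hG : ∀ᶠ q in 𝓝 (p.1, y), U q • spaceGrad W (q.1, X q) = q.2 := by
    filter_upwards [hright, hfst] with q hq hq'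
    rw [← hq']
    exact congrArg Prod.snd hq
  have hL : ∀ᶠ q in 𝓝 (p.1, y), U q * legendreExpr W (q.1, X q) = 1 := by
    filter_upwards [hfst, hΨt.eventually (hDc.continuousAt.eventually_ne hD)] with q hq hq'
    rw [← hq]
    exact inv_mul_cancel₀ hq'
  have heq : ∀ᶠ q in 𝓝 (p.1, y), U q * W (q.1, X q) = ⟪X q, q.2⟫ - 1 := by
    filter_upwards [hG, hL] with q h1 h2
    rw [legendreExpr] at h2
    rw [← h1, inner_smul_right]
    linarith
  have hFD : ∀ᶠ q in 𝓝 (p.1, y), HasFDerivAt U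
    ((W (q.1, X q))⁻¹ • ((innerSL ℝ (X q)).comp (ContinuousLinearMap.snd ℝ ℝ (Euc n)) -
      (U q * timeDeriv W (q.1, X q)) • ContinuousLinearMap.fst ℝ ℝ (Euc n))) q := by
    filter_upwards [hG, heq.eventually_nhds, hfst, eventually_differentiableAt one_ne_zero hUc,
      eventually_differentiableAt one_ne_zero hXc,
      hΨt.eventually (eventually_differentiableAt two_ne_zero hW),
      hΨt.eventually (hW.continuousAt.eventually_ne hW0)] with q hG heq hfst hUd hXd hWd hWne
    rw [hfst] at hWd hWne
    change DifferentiableAt ℝ W (q.1, X q) at hWd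
    change W (q.1, X q) ≠ 0 at hWne
    have h1 := hUd.hasFDerivAt.mul (hWd.hasFDerivAt.comp (f := fun q => (q.1, X q)) q
      (hasFDerivAt_fst.prodMk hXd.hasFDerivAt))
    have h2 := (hXd.hasFDerivAt.inner ℝ (hasFDerivAt_snd (𝕜 := ℝ) (p := q))).sub_const (1 : ℝ)
    have h3 := h1.unique (h2.congr_of_eventuallyEq heq)
    refine hUd.hasFDerivAt.congr_fderiv ?_
    refine ContinuousLinearMap.ext fun w => ?_
    have h4 := congrArg (fun l => l w) h3
    simp [fderivInnerCLM_apply, fderiv_eq hWd] at h4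
    have h5 : ⟪fderiv ℝ X q w, q.2⟫ = U q * ⟪spaceGrad W (q.1, X q), fderiv ℝ X q w⟫ := by
      rw [← hG, inner_smul_right, real_inner_comm]
    rw [h5] at h4
    simp only [_root_.smul_apply, _root_.sub_apply,
      ContinuousLinearMap.comp_apply, ContinuousLinearMap.coe_snd', ContinuousLinearMap.coe_fst',
      innerSL_apply_apply, smul_eq_mul]
    rw [eq_inv_mul_iff_mul_eq₀ hWne]
    linarith
  refine ⟨X, U, congrArg Prod.snd hΨp, hXc, ?_, hG, hL, hFD⟩
  have h21 : (2 : WithTop ℕ∞) = ((1 : ℕ) : WithTop ℕ∞) + 1 := by norm_num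
  rw [h21, contDiffAt_succ_iff_hasFDerivAt]
  refine ⟨_, eventually_iff_exists_mem.1 hFD, ?_⟩
  have hpair : ContDiffAt ℝ 1 (fun q : ℝ × Euc n => (q.1, X q)) (p.1, y) :=
    contDiffAt_fst.prodMk hXc
  have hpt : (p.1, X (p.1, y)) = p := Prod.ext rfl (show X (p.1, y) = p.2 from congrArg Prod.snd hΨp)
  have hWX : ContDiffAt ℝ 1 (fun q : ℝ × Euc n => W (q.1, X q)) (p.1, y) :=
    ContDiffAt.comp (g := W) (f := fun q : ℝ × Euc n => (q.1, X q)) _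
      (by rw [hpt]; exact hW.of_le (by norm_num)) hpair
  have hTX : ContDiffAt ℝ 1 (fun q : ℝ × Euc n => timeDeriv W (q.1, X q)) (p.1, y) :=
    ContDiffAt.comp (g := timeDeriv W) (f := fun q : ℝ × Euc n => (q.1, X q)) _
      (by rw [hpt]; exact contDiffAt_timeDeriv hW) hpair
  refine (hWX.inv (by rw [hpt]; exact hW0)).smul (ContDiffAt.sub ?_ ?_)
  · exact ((innerSL ℝ (E := Euc n)).contDiff.contDiffAt.comp _ hXc).clm_comp contDiffAt_const
  · exact (hUc.mul hTX).smul contDiffAt_const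

namespace LocalPolar

variable {W U : ℝ × Euc n → ℝ} {p : ℝ × Euc n} {y : Euc n} {X : ℝ × Euc n → Euc n}

theorem spaceGrad_eq (h : LocalPolar W p y X U) :
    ∀ᶠ q in 𝓝 (p.1, y), spaceGrad U q = (W (q.1, X q))⁻¹ • X q := by
  filter_upwards [h.hasFDerivAt] with q hq
  refine ext_inner_right ℝ fun v => ?_
  rw [inner_spaceGrad hq.differentiableAt, hq.fderiv, real_inner_smul_left]
  simp

theorem timeDeriv_eq (h : LocalPolar W p y X U) :
    ∀ᶠ q in 𝓝 (p.1, y), timeDeriv U q = -(U q * timeDeriv W (q.1, X q) / W (q.1, X q)) := by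
  filter_upwards [h.hasFDerivAt] with q hq
  rw [timeDeriv, hq.fderiv]
  simp
  ring

theorem differentiableAt_point (h : LocalPolar W p y X U) : DifferentiableAt ℝ X (p.1, y) :=
  h.contDiffAt_point.differentiableAt (by norm_num)

theorem hasFDerivAt_comp (h : LocalPolar W p y X U) {F : Type*} [NormedAddCommGroup F]
    [NormedSpace ℝ F] {V : ℝ × Euc n → F} (hV : DifferentiableAt ℝ V p) :
    HasFDerivAt (fun q => V (q.1, X q)) ((fderiv ℝ V p).comp
      ((ContinuousLinearMap.fst ℝ ℝ (Euc n)).prod (fderiv ℝ X (p.1, y)))) (p.1, y) := by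
  have hp : ((p.1, y).1, X (p.1, y)) = p := Prod.ext rfl h.apply
  refine HasFDerivAt.comp (g := V) (f := fun q : ℝ × Euc n => (q.1, X q)) (p.1, y) ?_
    (hasFDerivAt_fst.prodMk h.differentiableAt_point.hasFDerivAt)
  rw [hp]
  exact hV.hasFDerivAt

theorem fderiv_apply (h : LocalPolar W p y X U) (w : ℝ × Euc n) :
    fderiv ℝ U (p.1, y) w = (W p)⁻¹ * (⟪p.2, w.2⟫ - U (p.1, y) * timeDeriv W p * w.1) := by
  have hq := h.hasFDerivAt.self_of_nhds
  rw [hq.fderiv]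
  simp only [h.apply]
  simp

theorem mul_legendreExpr_self (h : LocalPolar W p y X U) : U (p.1, y) * legendreExpr W p = 1 := by
  have := h.mul_legendreExpr.self_of_nhds
  rwa [show ((p.1, y).1, X (p.1, y)) = p from Prod.ext rfl h.apply] at this

theorem fderiv_relation (h : LocalPolar W p y X U) (hW : ContDiffAt ℝ 2 W p) (w : ℝ × Euc n) :
    ((W p)⁻¹ * (⟪p.2, w.2⟫ - U (p.1, y) * timeDeriv W p * w.1)) • spaceGrad W p +
      U (p.1, y) • fderiv ℝ (spaceGrad W) p (w.1, fderiv ℝ X (p.1, y) w) = w.2 := by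
  have hG := (contDiffAt_spaceGrad hW).differentiableAt (by norm_num)
  have hU := h.contDiffAt.differentiableAt (by norm_num)
  have h1 := hU.hasFDerivAt.smul (h.hasFDerivAt_comp hG)
  have h2 := h1.unique ((hasFDerivAt_snd (𝕜 := ℝ)).congr_of_eventuallyEq h.smul_spaceGrad)
  have h3 := congrArg (fun l => l w) h2
  have hp : (p.1, X (p.1, y)) = p := Prod.ext rfl h.apply
  simp only [hp] at h3
  rw [← h.fderiv_apply, add_comm]
  simpa using h3

theorem hess_pos (h : LocalPolar W p y X U) (hW : ContDiffAt ℝ 2 W p) (hW0 : 0 < W p)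
    (hU : 0 < U (p.1, y)) (hH : ∀ v, v ≠ 0 → 0 < ⟪v, hess (fun z => W (p.1, z)) p.2 v⟫)
    {v : Euc n} (hv : v ≠ 0) : 0 < ⟪v, hess (fun z => U (p.1, z)) y v⟫ := by
  have hWd := hW.differentiableAt (by norm_num)
  have hp : (p.1, X (p.1, y)) = p := Prod.ext rfl h.apply
  have hrel := h.fderiv_relation hW (0, v)
  have hess_eq := hess_apply h.contDiffAt v
  change hess (fun z => U (p.1, z)) y v = _ at hess_eq
  have hd : HasFDerivAt (spaceGrad U) _ (p.1, y) :=
    (((hasDerivAt_inv (by simp only [hp]; exact hW0.ne')).comp_hasFDerivAt (p.1, y)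
      (h.hasFDerivAt_comp hWd)).smul
        h.differentiableAt_point.hasFDerivAt).congr_of_eventuallyEq h.spaceGrad_eq
  set x' := fderiv ℝ X (p.1, y) (0, v) with hx'
  have hx'0 : x' ≠ 0 := by
    intro h0
    rw [h0] at hrel
    simp only [Prod.mk_zero_zero, map_zero, smul_zero, add_zero, mul_zero, sub_zero] at hrel
    have h1 := congrArg (fun z => ⟪p.2, z⟫) hrel
    simp only [inner_smul_right] at h1
    have hD := h.mul_legendreExpr_self
    rw [legendreExpr] at hD
    have h2 : ⟪p.2, v⟫ * (⟪p.2, spaceGrad W p⟫ - W p) = 0 := by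
      field_simp at h1
      linarith
    have h3 : ⟪p.2, v⟫ = 0 := (mul_eq_zero.1 h2).resolve_right (by
      intro h4; rw [h4, mul_zero] at hD; exact zero_ne_one hD)
    rw [h3, mul_zero, zero_smul] at hrel
    exact hv hrel.symm
  have hpos := hH x' hx'0
  rw [hess_apply hW] at hpos
  have hval : hess (fun z => U (p.1, z)) y v =
      (W p)⁻¹ • x' - ((W p ^ 2)⁻¹ * ⟪spaceGrad W p, x'⟫) • p.2 := by
    rw [hess_eq, hd.fderiv]
    simp [h.apply, fderiv_eq hWd, ← hx', sub_eq_add_neg]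
  have h1 := congrArg (fun z => ⟪z, x'⟫) hrel
  simp only [inner_add_left, real_inner_smul_left, mul_zero, sub_zero] at h1
  rw [real_inner_comm] at hpos
  rw [hval, inner_sub_right, inner_smul_right, inner_smul_right, real_inner_comm p.2 v, ← h1]
  have : 0 < (W p)⁻¹ * (U (p.1, y) * ⟪fderiv ℝ (spaceGrad W) p (0, x'), x'⟫) := by positivity
  convert this using 1
  field_simp
  ring

/-- The second time derivative of the polar transform in terms of the polar Monge–Ampère
operator. -/
theorem deriv_deriv (h : LocalPolar W p y X U) (hW : ContDiffAt ℝ 2 W p) (hW0 : W p ≠ 0)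
    (hH : ∀ v, v ≠ 0 → hess (fun z => W (p.1, z)) p.2 v ≠ 0) {q : Euc n}
    (hq : hess (fun z => W (p.1, z)) p.2 q =
      gradient (fun z => deriv (fun s => W (s, z)) p.1 / W (p.1, z)) p.2) :
    deriv (fun s => deriv (fun r => U (r, y)) s) p.1 = U (p.1, y) * W p *
      (deriv (fun s => deriv (fun r => (W (r, p.2))⁻¹) s) p.1 +
        ⟪gradient (fun z => deriv (fun s => W (s, z)) p.1 / W (p.1, z)) p.2, q⟫) := by
  have hp : (p.1, X (p.1, y)) = p := Prod.ext rfl h.apply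
  have hWd := hW.differentiableAt (by norm_num)
  have hAd := (contDiffAt_timeDeriv hW).differentiableAt (by norm_num)
  have hev := eventually_differentiableAt two_ne_zero hW
  have htime : Tendsto (fun s : ℝ => (s, p.2)) (𝓝 p.1) (𝓝 p) :=
    (by fun_prop : Continuous fun s : ℝ => (s, p.2)).tendsto' _ _ rfl
  have hspace : Tendsto (fun z : Euc n => (p.1, z)) (𝓝 p.2) (𝓝 p) :=
    (by fun_prop : Continuous fun z : Euc n => (p.1, z)).tendsto' _ _ rfl
  have htimeU : Tendsto (fun s : ℝ => (s, y)) (𝓝 p.1) (𝓝 (p.1, y)) :=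
    (by fun_prop : Continuous fun s : ℝ => (s, y)).tendsto' _ _ rfl
  set A := timeDeriv W p with hA
  set G := spaceGrad W p with hG
  set Gt := fderiv ℝ (spaceGrad W) p (1, 0) with hGt
  set γ := gradient (fun z => deriv (fun s => W (s, z)) p.1 / W (p.1, z)) p.2 with hγ
  -- the space gradient of `∂ₜW / W`
  have hγ_eq : γ = (W p)⁻¹ • (Gt - (A / W p) • G) := by
    have hWs := hWd.hasFDerivAt.comp (f := fun z : Euc n => (p.1, z)) p.2
      (hasFDerivAt_prodMk_right p.1 p.2)
    have h1 := (hAd.hasFDerivAt.comp (f := fun z : Euc n => (p.1, z)) p.2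
      (hasFDerivAt_prodMk_right p.1 p.2)).mul
        ((hasDerivAt_inv (show (W ∘ fun z : Euc n => (p.1, z)) p.2 ≠ 0 from hW0)).comp_hasFDerivAt
          p.2 hWs)
    have h2 := h1.congr_of_eventuallyEq
      (f₁ := fun z => deriv (fun s => W (s, z)) p.1 / W (p.1, z)) (by
        filter_upwards [hspace.eventually hev] with z hz
        rw [(hasDerivAt_time hz).deriv, div_eq_mul_inv]
        rfl)
    refine ext_inner_right ℝ fun v => ?_
    rw [hγ, inner_gradient_left, h2.fderiv, real_inner_smul_left, inner_sub_left,
      real_inner_smul_left]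
    simp [fderiv_timeDeriv_space hW, fderiv_eq hWd, ← hGt, ← hG, ← hA]
    field_simp
    ring
  -- the second time derivative of `1 / W`
  have hinv : deriv (fun s => deriv (fun r => (W (r, p.2))⁻¹) s) p.1 =
      -fderiv ℝ (timeDeriv W) p (1, 0) / W p ^ 2 + 2 * A ^ 2 / W p ^ 3 := by
    have h1 : (fun s => deriv (fun r => (W (r, p.2))⁻¹) s) =ᶠ[𝓝 p.1]
        fun s => -timeDeriv W (s, p.2) / W (s, p.2) ^ 2 := by
      filter_upwards [htime.eventually hev,
        htime.eventually (hW.continuousAt.eventually_ne hW0)] with s hs hs0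
      exact ((hasDerivAt_time hs).fun_inv hs0).deriv
    have h2 := (hasDerivAt_time hAd).fun_neg.fun_div ((hasDerivAt_time hWd).fun_pow 2)
      (pow_ne_zero 2 hW0)
    rw [h1.deriv_eq, h2.deriv]
    change _ = _
    rw [← timeDeriv.eq_1 W p, ← hA]
    field_simp
    push_cast
    ring
  -- the second time derivative of `U`
  set x' := fderiv ℝ X (p.1, y) (1, 0) with hx'
  have hUU : deriv (fun s => deriv (fun r => U (r, y)) s) p.1 = U (p.1, y) * A ^ 2 / W p ^ 2 -
      U (p.1, y) * ((fderiv ℝ (timeDeriv W) p (1, 0) + ⟪Gt, x'⟫) * W p - A * (A + ⟪G, x'⟫)) /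
        W p ^ 2 := by
    have hWne : ∀ᶠ s in 𝓝 p.1, W (s, X (s, y)) ≠ 0 := by
      have hc : ContinuousAt (fun q : ℝ × Euc n => W (q.1, X q)) (p.1, y) :=
        (h.hasFDerivAt_comp hWd).continuousAt
      exact htimeU.eventually (hc.eventually_ne (by simp only [hp]; exact hW0))
    have h1 : (fun s => deriv (fun r => U (r, y)) s) =ᶠ[𝓝 p.1]
        fun s => -(U (s, y) * timeDeriv W (s, X (s, y)) / W (s, X (s, y))) := by
      filter_upwards [htimeU.eventually h.timeDeriv_eq,
        htimeU.eventually h.hasFDerivAt] with s hs hs'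
      rw [← hs]
      exact (hasDerivAt_time hs'.differentiableAt).deriv
    have hUt := hasDerivAt_time (h.contDiffAt.differentiableAt (by norm_num))
    have hAt := hasDerivAt_time (h.hasFDerivAt_comp hAd).differentiableAt
    have hWt := hasDerivAt_time (h.hasFDerivAt_comp hWd).differentiableAt
    rw [(h.hasFDerivAt_comp hAd).fderiv] at hAt
    rw [(h.hasFDerivAt_comp hWd).fderiv] at hWt
    have h2 := ((hUt.fun_mul hAt).fun_div hWt (by simp only [hp]; exact hW0)).fun_neg
    rw [h1.deriv_eq]
    refine h2.deriv.trans ?_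
    have h3 : fderiv ℝ (timeDeriv W) p (1, x') = fderiv ℝ (timeDeriv W) p (1, 0) + ⟪Gt, x'⟫ := by
      rw [hGt, ← fderiv_timeDeriv_space hW, ← map_add]
      simp
    simp only [hp, ContinuousLinearMap.comp_apply, ContinuousLinearMap.prod_apply,
      ContinuousLinearMap.coe_fst', ← hx', h3, fderiv_eq hWd, h.fderiv_apply, inner_zero_right,
      ← hA, ← hG]
    field_simp
    ring
  have hrel := h.fderiv_relation hW (1, 0)
  simp only [inner_zero_right, ← hx', ← hA, ← hG] at hrel
  have hU0 : U (p.1, y) ≠ 0 := fun h0 => by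
    have := h.mul_legendreExpr_self
    rw [h0, zero_mul] at this
    exact zero_ne_one this
  have hHx : fderiv ℝ (spaceGrad W) p (0, x') = -(W p) • γ := by
    have h3 : fderiv ℝ (spaceGrad W) p (1, x') = Gt + fderiv ℝ (spaceGrad W) p (0, x') := by
      rw [hGt, ← map_add]
      simp
    rw [h3] at hrel
    have h4 : U (p.1, y) • (fderiv ℝ (spaceGrad W) p (0, x') + (Gt - (A / W p) • G)) = 0 := by
      rw [← hrel]
      module
    have h5 := (smul_eq_zero.1 h4).resolve_left hU0
    rw [hγ_eq, smul_smul, neg_mul, mul_inv_cancel₀ hW0, neg_smul, one_smul]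
    exact eq_neg_of_add_eq_zero_left h5
  have hxq : x' = -(W p) • q := by
    have h0 : hess (fun z => W (p.1, z)) p.2 (x' + W p • q) = 0 := by
      rw [map_add, map_smul, hq, hess_apply hW, hHx, neg_smul, neg_add_cancel]
    by_contra hne
    refine hH _ (fun h1 => hne ?_) h0
    rw [neg_smul]
    exact eq_neg_of_add_eq_zero_left h1
  have hγx : ⟪γ, x'⟫ = -(W p) * ⟪γ, q⟫ := by rw [hxq, inner_smul_right]
  have hγx' : ⟪γ, x'⟫ = (W p)⁻¹ * (⟪Gt, x'⟫ - A / W p * ⟪G, x'⟫) := by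
    rw [hγ_eq, real_inner_smul_left, inner_sub_left, real_inner_smul_left]
  have hγq : ⟪γ, q⟫ = -(W p)⁻¹ * ((W p)⁻¹ * (⟪Gt, x'⟫ - A / W p * ⟪G, x'⟫)) := by
    rw [← hγx', hγx]
    field_simp
  rw [hUU, hinv, hγq]
  field_simp
  ring

end LocalPolar

/-- The polar transform of a real-valued function, as a real-valued function. -/
def pol (f : Euc n → ℝ) (y : Euc n) : ℝ := (polarT (fun z => ENNReal.ofReal (f z)) y).toReal

theorem polarT_zero (f : Euc n → ℝ≥0∞) : polarT f 0 = 0 :=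
  le_antisymm (sInf_le fun x => by simp) zero_le

theorem pol_nonneg (f : Euc n → ℝ) (y : Euc n) : 0 ≤ pol f y := ENNReal.toReal_nonneg

theorem pol_zero (f : Euc n → ℝ) : pol f 0 = 0 := by simp [pol, polarT_zero]

theorem pol_le {f : Euc n → ℝ} {y : Euc n} {c : ℝ} (hc : 0 ≤ c)
    (h : ∀ z, ⟪z, y⟫ ≤ 1 + c * f z) : pol f y ≤ c := by
  refine ENNReal.toReal_le_of_le_ofReal hc (sInf_le fun z => ?_)
  rw [← ENNReal.ofReal_mul hc]
  calc ENNReal.ofReal ⟪z, y⟫ ≤ ENNReal.ofReal (1 + c * f z) := ENNReal.ofReal_le_ofReal (h z)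
    _ ≤ ENNReal.ofReal 1 + ENNReal.ofReal (c * f z) := ENNReal.ofReal_add_le
    _ = _ := by simp

namespace PolarDual

variable {f : Euc n → ℝ} {x y : Euc n} {c : ℝ}

theorem polarT_eq (h : PolarDual f x y c) (hf : Admissible f) :
    polarT (fun z => ENNReal.ofReal (f z)) y = ENNReal.ofReal c := by
  refine le_antisymm (sInf_le fun z => ?_) (le_sInf fun b hb => ?_)
  · rw [← ENNReal.ofReal_mul h.pos.le]
    calc ENNReal.ofReal ⟪z, y⟫ ≤ ENNReal.ofReal (1 + c * f z) := ENNReal.ofReal_le_ofReal (h.le z)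
      _ ≤ ENNReal.ofReal 1 + ENNReal.ofReal (c * f z) := ENNReal.ofReal_add_le
      _ = _ := by simp
  · rcases eq_or_ne b ∞ with rfl | hb'
    · exact le_top
    lift b to NNReal using hb'
    have h1 := hb x
    have h2 : (1 : ℝ≥0∞) + b * ENNReal.ofReal (f x) = ENNReal.ofReal (1 + b * f x) := by
      rw [ENNReal.ofReal_add one_pos.le (mul_nonneg b.coe_nonneg (hf.nonneg x)), ENNReal.ofReal_mul b.coe_nonneg]
      simp
    rw [h2, ENNReal.ofReal_le_ofReal_iff (add_nonneg one_pos.le (mul_nonneg b.coe_nonneg (hf.nonneg x)))]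
      at h1
    have h3 := h.eq
    have h4 : c * f x ≤ b * f x := by linarith
    have h5 := le_of_mul_le_mul_right h4 (hf.pos h.ne)
    exact ENNReal.ofReal_le_of_le_toReal h5

theorem pol_eq (h : PolarDual f x y c) (hf : Admissible f) : pol f y = c := by
  rw [pol, h.polarT_eq hf, ENNReal.toReal_ofReal h.pos.le]

end PolarDual

namespace Admissible

variable {f g : Euc n → ℝ}

theorem polarT_eq (hf : Admissible f) :
    polarT (fun z => ENNReal.ofReal (f z)) = fun y => ENNReal.ofReal (pol f y) := by
  funext y
  rcases eq_or_ne y 0 with rfl | hy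
  · rw [pol_zero, polarT_zero, ENNReal.ofReal_zero]
  · obtain ⟨x, c, h⟩ := hf.exists_polarDual hy
    rw [h.polarT_eq hf, h.pol_eq hf]

theorem inner_le (hf : Admissible f) (z y : Euc n) : ⟪z, y⟫ ≤ 1 + pol f y * f z := by
  rcases eq_or_ne y 0 with rfl | hy
  · simp [pol_zero]
  · obtain ⟨x, c, h⟩ := hf.exists_polarDual hy
    rw [h.pol_eq hf]
    exact h.le z

theorem pol_pos (hf : Admissible f) {y : Euc n} (hy : y ≠ 0) : 0 < pol f y := by
  obtain ⟨x, c, h⟩ := hf.exists_polarDual hy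
  rw [h.pol_eq hf]
  exact h.pos

theorem exists_polarDual_pol (hf : Admissible f) {y : Euc n} (hy : y ≠ 0) :
    ∃ x, PolarDual f x y (pol f y) := by
  obtain ⟨x, c, h⟩ := hf.exists_polarDual hy
  rw [h.pol_eq hf]
  exact ⟨x, h⟩

/-- Polar duality determines the functional up to the point. -/
theorem polarDual_unique (hf : Admissible f) {x y y' : Euc n} {c c' : ℝ}
    (h : PolarDual f x y c) (h' : PolarDual f x y' c') : y = y' := by
  have h1 := h.mul_sub_eq_one hf
  have h2 := h'.mul_sub_eq_one hf
  have h3 := sub_pos.2 (hf.lt_inner_gradient h.ne)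
  have h4 : c = c' := mul_right_cancel₀ h3.ne' (h1.trans h2.symm)
  rw [← h.gradient_eq hf, ← h'.gradient_eq hf, h4]

theorem pol_strictConvex (hf : Admissible f) : StrictConvexOn ℝ univ (pol f) := by
  refine ⟨convex_univ, fun y₁ _ y₂ _ hne a b ha hb hab => ?_⟩
  simp only [smul_eq_mul]
  rcases eq_or_ne (a • y₁ + b • y₂) 0 with h0 | h0
  · rw [h0, pol_zero]
    rcases eq_or_ne y₁ 0 with h1 | h1
    · have h2 : y₂ ≠ 0 := fun h => hne (h1.trans h.symm)
      have := mul_pos hb (hf.pol_pos h2)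
      have := mul_nonneg ha.le (pol_nonneg f y₁)
      linarith
    · have := mul_pos ha (hf.pol_pos h1)
      have := mul_nonneg hb.le (pol_nonneg f y₂)
      linarith
  obtain ⟨x, h⟩ := hf.exists_polarDual_pol h0
  have hfx := hf.pos h.ne
  have e := h.eq
  rw [inner_add_right, inner_smul_right, inner_smul_right] at e
  have i1 := hf.inner_le x y₁
  have i2 := hf.inner_le x y₂
  have dual : ∀ y, pol f y * f x = ⟪x, y⟫ - 1 → PolarDual f x y (pol f y) := fun y hy => by
    refine ⟨h.ne, ?_, hy, fun z => hf.inner_le z y⟩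
    refine hf.pol_pos fun h1 => ?_
    rw [h1, pol_zero, inner_zero_right] at hy
    norm_num at hy
  have key : (pol f (a • y₁ + b • y₂)) * f x < (a * pol f y₁ + b * pol f y₂) * f x := by
    by_contra! hcon
    have j1 := mul_le_mul_of_nonneg_left i1 ha.le
    have j2 := mul_le_mul_of_nonneg_left i2 hb.le
    have k1 : a * (pol f y₁ * f x - (⟪x, y₁⟫ - 1)) = 0 := by linarith
    have k2 : b * (pol f y₂ * f x - (⟪x, y₂⟫ - 1)) = 0 := by linarith
    have l1 := sub_eq_zero.1 ((mul_eq_zero.1 k1).resolve_left ha.ne')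
    have l2 := sub_eq_zero.1 ((mul_eq_zero.1 k2).resolve_left hb.ne')
    exact hne (hf.polarDual_unique (dual _ l1) (dual _ l2))
  exact lt_of_mul_lt_mul_right key hfx.le

theorem pol_nonlinear (hf : Admissible f) (y : Euc n) (hy : y ≠ 0) :
    ¬ ∃ a b : ℝ, 0 ≤ a ∧ 0 < b ∧ ∀ t : ℝ, 0 ≤ t →
      a * t - b ≤ pol f (t • y) ∧ pol f (t • y) ≤ a * t := by
  rintro ⟨a, b, ha, hb, H⟩
  have ha' : 0 < a := by
    have := (H 1 zero_le_one).2
    rw [one_smul, mul_one] at this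
    exact (hf.pol_pos hy).trans_le this
  have hle : ∀ x, ⟪x, y⟫ ≤ a * f x := fun x => by
    by_contra! hcon
    have hd := sub_pos.2 hcon
    have ht : 0 < 2 / (⟪x, y⟫ - a * f x) := by positivity
    have h1 := hf.inner_le x ((2 / (⟪x, y⟫ - a * f x)) • y)
    have h2 := mul_le_mul_of_nonneg_right (H _ ht.le).2 (hf.nonneg x)
    rw [inner_smul_right] at h1
    have h3 : 2 / (⟪x, y⟫ - a * f x) * (⟪x, y⟫ - a * f x) = 2 := div_mul_cancel₀ _ hd.ne'
    nlinarith
  have hlt : ∀ x, x ≠ 0 → ⟪x, y⟫ < a * f x := fun x hx => by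
    have h1 := hle ((1 / 2 : ℝ) • x)
    have h2 := hf.smul_lt (s := 1 / 2) (by norm_num) (by norm_num) hx
    rw [real_inner_smul_left] at h1
    nlinarith
  obtain ⟨ρ, hρ, hρ'⟩ : ∃ ρ > 0, ∀ x, ‖x‖ < 2 * ρ → f x < 1 / (2 * b) := by
    have h1 : Tendsto f (𝓝 0) (𝓝 0) := hf.continuous.tendsto' _ _ hf.zero
    obtain ⟨ρ, hρ, h2⟩ := Metric.eventually_nhds_iff.1
      (h1.eventually_lt_const (show 0 < 1 / (2 * b) by positivity))
    refine ⟨ρ / 2, by positivity, fun x hx => h2 ?_⟩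
    rw [dist_zero_right]
    linarith
  obtain ⟨C, hC, hC'⟩ := hf.exists_mul_norm_le hρ
  obtain ⟨m, hm, hm'⟩ := (isCompact_sphere (0 : Euc n) ρ).exists_forall_le'
    (f := fun x => a - ⟪x, y⟫ / f x) (a := 0)
    (by
      refine continuousOn_const.sub (ContinuousOn.div (by fun_prop) hf.continuous.continuousOn ?_)
      intro x hx
      refine (hf.pos ?_).ne'
      rintro rfl
      simp at hx
      exact hρ.ne hx)
    (fun x hx => by
      have hx0 : x ≠ 0 := by
        rintro rfl
        simp at hx
        exact hρ.ne hx
      rw [sub_pos, div_lt_iff₀ (hf.pos hx0)]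
      exact hlt x hx0)
  set ε := min m a with hε
  have hε0 : 0 < ε := lt_min hm ha'
  have hout : ∀ x, ρ ≤ ‖x‖ → ⟪x, y⟫ ≤ (a - ε) * f x := by
    refine hf.le_of_le_on_sphere (ψ := fun x => ⟪x, y⟫)
      (fun s _ z => real_inner_smul_left _ _ _) (sub_nonneg.2 (min_le_right _ _)) hρ fun x hx => ?_
    have hx0 : x ≠ 0 := by
      rintro rfl
      simp at hx
      exact hρ.ne hx
    have h1 := hm' x (by simpa using hx)
    have h2 : ⟪x, y⟫ / f x ≤ a - ε := by
      have := min_le_left m a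
      linarith
    rwa [div_le_iff₀ (hf.pos hx0)] at h2
  set t := 2 * b / ε with ht
  have htε : t * ε = 2 * b := div_mul_cancel₀ _ hε0.ne'
  have ht0 : 0 < t := by positivity
  have hta : 0 ≤ a * t - 2 * b := by
    have : ε * t ≤ a * t := by gcongr; exact min_le_right _ _
    linarith
  have hup : pol f (t • y) ≤ a * t - 2 * b := by
    refine pol_le hta fun z => ?_
    rw [inner_smul_right]
    rcases lt_or_ge ‖z‖ ρ with hz | hz
    · have h1 := mul_le_mul_of_nonneg_left (hle z) ht0.le
      have h2 := mul_le_mul_of_nonneg_left (hρ' z (by linarith)).le (by positivity : 0 ≤ 2 * b)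
      rw [mul_one_div_cancel (by positivity : 2 * b ≠ 0)] at h2
      linarith
    · have h1 := mul_le_mul_of_nonneg_left (hout z hz) ht0.le
      have : t * ((a - ε) * f z) = (a * t - 2 * b) * f z := by rw [← htε]; ring
      linarith
  have := (H t ht0.le).1
  linarith

end Admissible

theorem hess_congr {φ ψ : Euc n → ℝ} {x : Euc n} (h : φ =ᶠ[𝓝 x] ψ) : hess φ x = hess ψ x :=
  Filter.EventuallyEq.fderiv_eq h.gradient

/-- The polar transforms of a family of functions form a local polar transform. -/
theorem exists_localPolar_pol {f : ℝ → Euc n → ℝ} {A : Set ℝ} {t : ℝ} {x y : Euc n} {c : ℝ}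
    (ht : t ∈ A) (hf : ∀ s ∈ A, Admissible (f s))
    (hW : ContDiffAt ℝ 2 (fun q : ℝ × Euc n => f q.1 q.2) (t, x)) (h : PolarDual (f t) x y c) :
    ∃ X U, LocalPolar (fun q : ℝ × Euc n => f q.1 q.2) (t, x) y X U ∧
      ∀ᶠ q in 𝓝 (t, y), q.1 ∈ A → U q = pol (f q.1) q.2 := by
  have hc := h.mul_sub_eq_one (hf t ht)
  obtain ⟨X, U, hU⟩ := exists_localPolar (p := (t, x)) (y := y) hW ((hf t ht).pos h.ne).ne'
    (sub_pos.2 ((hf t ht).lt_inner_gradient h.ne)).ne'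
    (fun v hv h0 => by
      have := (hf t ht).hess_pos x h.ne v hv
      rw [show hess (f t) x v = 0 from h0, inner_zero_right] at this
      exact this.false)
    (by
      rw [← h.gradient_eq (hf t ht)]
      exact congrArg (· • gradient (f t) x) (eq_inv_of_mul_eq_one_left hc).symm)
  refine ⟨X, U, hU, ?_⟩
  have hX : ∀ᶠ q in 𝓝 (t, y), X q ≠ 0 :=
    hU.differentiableAt_point.continuousAt.eventually_ne (by rw [hU.apply]; exact h.ne)
  filter_upwards [hX, hU.smul_spaceGrad, hU.mul_legendreExpr] with q h1 h2 h3 hq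
  exact (((hf _ hq).polarDual_of_gradient h1 h2 h3).pol_eq (hf _ hq)).symm

namespace Admissible

variable {f g : Euc n → ℝ}

protected theorem pol (hf : Admissible f) : Admissible (pol f) := by
  have hloc : ∀ y, y ≠ 0 → ContDiffAt ℝ 2 (PolarMongeAmpere.pol f) y ∧
      ∀ v, v ≠ 0 → 0 < ⟪v, hess (PolarMongeAmpere.pol f) y v⟫ := by
    intro y hy
    obtain ⟨x, h⟩ := hf.exists_polarDual_pol hy
    have hW : ContDiffAt ℝ 2 (fun q : ℝ × Euc n => f q.2) (0, x) :=
      (hf.contDiffAt h.ne).comp (f := fun q : ℝ × Euc n => q.2) (0, x) contDiffAt_snd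
    obtain ⟨X, U, hU, hUe⟩ := exists_localPolar_pol (f := fun _ => f) (mem_univ (0 : ℝ))
      (fun _ _ => hf) hW h
    have he : (fun z => U (0, z)) =ᶠ[𝓝 y] PolarMongeAmpere.pol f := by
      have hs : Tendsto (fun z : Euc n => ((0 : ℝ), z)) (𝓝 y) (𝓝 (0, y)) :=
        (by fun_prop : Continuous fun z : Euc n => ((0 : ℝ), z)).tendsto' _ _ rfl
      filter_upwards [hs.eventually hUe] with z hz using hz (mem_univ _)
    refine ⟨?_, fun v hv => ?_⟩
    · have h1 : ContDiffAt ℝ 2 (fun z : Euc n => U (0, z)) y :=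
        hU.contDiffAt.comp (f := fun z : Euc n => ((0 : ℝ), z)) y
          (contDiffAt_const.prodMk contDiffAt_id)
      exact h1.congr_of_eventuallyEq he.symm
    · rw [← hess_congr he]
      refine hU.hess_pos hW (hf.pos h.ne) ?_ (hf.hess_pos x h.ne) hv
      have := he.self_of_nhds
      simp only at this
      rw [this]
      exact hf.pol_pos hy
  exact ⟨pol_zero f, pol_nonneg f, hf.pol_strictConvex,
    fun y hy => (hloc y hy).1.contDiffWithinAt, fun y hy => (hloc y hy).2, hf.pol_nonlinear⟩

theorem polarDual_pol (hf : Admissible f) {x y : Euc n} {c : ℝ} (h : PolarDual f x y c) :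
    PolarDual (PolarMongeAmpere.pol f) y x (f x) := by
  refine ⟨h.symm_ne hf, hf.pos h.ne, ?_, fun z => ?_⟩
  · rw [h.pol_eq hf, real_inner_comm, mul_comm, h.eq]
  · rw [real_inner_comm, mul_comm]
    exact hf.inner_le x z

theorem pol_pol (hf : Admissible f) : PolarMongeAmpere.pol (PolarMongeAmpere.pol f) = f := by
  funext x
  rcases eq_or_ne x 0 with rfl | hx
  · rw [pol_zero, hf.zero]
  · obtain ⟨y, c, -, h⟩ := hf.exists_polarDual_of_ne hx
    exact (hf.polarDual_pol h).pol_eq hf.pol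

theorem hasFDerivAt_gradient (hf : Admissible f) {x : Euc n} (hx : x ≠ 0) :
    HasFDerivAt (fun z => gradient f z) (hess f x) x := by
  have h1 : ContDiffAt ℝ 1 (fderiv ℝ f) x := (hf.contDiffAt hx).fderiv_right (by norm_num)
  have h2 := (InnerProductSpace.toDual ℝ (Euc n)).symm.toContinuousLinearEquiv.differentiableAt.comp
    x (h1.differentiableAt one_ne_zero)
  exact h2.hasFDerivAt

theorem add_nonlinear (hf : Admissible f) (hg : Admissible g) {a b : ℝ} (ha : 0 < a) (hb : 0 < b)
    (x : Euc n) (hx : x ≠ 0) : ¬ ∃ c d : ℝ, 0 ≤ c ∧ 0 < d ∧ ∀ t : ℝ, 0 ≤ t →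
      c * t - d ≤ a * f (t • x) + b * g (t • x) ∧ a * f (t • x) + b * g (t • x) ≤ c * t := by
  rintro ⟨c, d, hc, hd, H⟩
  have mono : ∀ {φ : Euc n → ℝ}, Admissible φ → ∀ s t : ℝ, 0 < t → t ≤ s →
      φ (t • x) / t ≤ φ (s • x) / s := fun {φ} hφ s t ht hts => by
    have hs := ht.trans_le hts
    have h1 := hφ.smul_le (div_pos ht hs).le ((div_le_one hs).2 hts) (s • x)
    rw [smul_smul, div_mul_cancel₀ _ hs.ne'] at h1
    rw [div_le_iff₀ ht]
    calc _ ≤ _ := h1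
      _ = _ := by ring
  have hdiv : ∀ t : ℝ, 0 < t → a * (f (t • x) / t) + b * (g (t • x) / t) ≤ c := fun t ht => by
    have := (H t ht.le).2
    rw [← div_le_iff₀ ht] at this
    calc _ = _ := by ring
      _ ≤ _ := this
  have hcross : ∀ s t : ℝ, 0 < s → 0 < t → f (s • x) / s ≤ (c - b * (g (t • x) / t)) / a := by
    intro s t hs ht
    have hm := hs.trans_le (le_max_left s t)
    have h1 := mono hf _ s hs (le_max_left s t)
    have h2 := mono hg _ t ht (le_max_right s t)
    rw [le_div_iff₀ ha]
    nlinarith [hdiv _ hm, mul_le_mul_of_nonneg_left h1 ha.le, mul_le_mul_of_nonneg_left h2 hb.le]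
  let S : Set ℝ := (fun s : ℝ => f (s • x) / s) '' Ioi 0
  have hS : S.Nonempty := (nonempty_Ioi (a := (0 : ℝ))).image _
  have hub : ∀ t : ℝ, 0 < t → (c - b * (g (t • x) / t)) / a ∈ upperBounds S := fun t ht => by
    rintro _ ⟨s, hs, rfl⟩
    exact hcross s t hs ht
  have hSle : ∀ t : ℝ, 0 < t → f (t • x) / t ≤ sSup S := fun t ht =>
    le_csSup ⟨_, hub 1 one_pos⟩ ⟨t, ht, rfl⟩
  refine hf.nonlinear x hx ⟨sSup S, d / a, ?_, by positivity, fun t ht => ?_⟩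
  · exact (div_nonneg (hf.nonneg _) zero_le_one).trans (hSle 1 one_pos)
  rcases ht.eq_or_lt with rfl | ht
  · simp [hf.zero]
    positivity
  refine ⟨?_, (div_le_iff₀ ht).1 (hSle t ht)⟩
  have h1 := csSup_le hS (hub t ht)
  rw [le_div_iff₀ ha] at h1
  have h2 := mul_le_mul_of_nonneg_right h1 ht.le
  have h3 : (c - b * (g (t • x) / t)) * t = c * t - b * g (t • x) := by field_simp
  have h4 := (H t ht.le).1
  have h5 : (sSup S * t - d / a) * a = sSup S * a * t - d := by field_simp
  rw [← mul_le_mul_iff_left₀ ha, h5]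
  linarith

theorem convexCombination (hf : Admissible f) (hg : Admissible g) {a b : ℝ} (ha : 0 ≤ a)
    (hb : 0 ≤ b) (hab : a + b = 1) : Admissible (fun x => a * f x + b * g x) := by
  rcases ha.eq_or_lt with rfl | ha
  · obtain rfl : b = 1 := by linarith
    simpa using hg
  rcases hb.eq_or_lt with rfl | hb
  · obtain rfl : a = 1 := by linarith
    simpa using hf
  refine ⟨by simp [hf.zero, hg.zero], fun x => ?_, ⟨convex_univ, ?_⟩, ?_, fun x hx v hv => ?_,
    hf.add_nonlinear hg ha hb⟩
  · exact add_nonneg (mul_nonneg ha.le (hf.nonneg x)) (mul_nonneg hb.le (hg.nonneg x))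
  · intro x hx y hy hne r s hr hs hrs
    have h1 := mul_lt_mul_of_pos_left (hf.strictConvex.2 hx hy hne hr hs hrs) ha
    have h2 := mul_lt_mul_of_pos_left (hg.strictConvex.2 hx hy hne hr hs hrs) hb
    simp only [smul_eq_mul] at *
    linarith
  · exact (contDiffOn_const.mul hf.contDiffOn).add (contDiffOn_const.mul hg.contDiffOn)
  · have he : (fun z => gradient (fun x => a * f x + b * g x) z) =ᶠ[𝓝 x]
        fun z => a • gradient f z + b • gradient g z := by
      filter_upwards [isOpen_compl_singleton.mem_nhds hx] with z hz
      refine ext_inner_right ℝ fun w => ?_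
      rw [inner_gradient_left, inner_add_left, real_inner_smul_left, real_inner_smul_left,
        inner_gradient_left, inner_gradient_left,
        (((hf.differentiableAt hz).hasFDerivAt.const_mul a).fun_add
          ((hg.differentiableAt hz).hasFDerivAt.const_mul b)).fderiv]
      simp
    have hd := (((hf.hasFDerivAt_gradient hx).const_smul a).add
      ((hg.hasFDerivAt_gradient hx).const_smul b)).congr_of_eventuallyEq he
    rw [hess, hd.fderiv]
    have h1 := mul_pos ha (hf.hess_pos x hx v hv)
    have h2 := mul_pos hb (hg.hess_pos x hx v hv)
    simp only [_root_.add_apply, _root_.smul_apply, inner_add_right, inner_smul_right]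
    exact add_pos h1 h2

theorem of_S2 {u : Euc n → ℝ≥0∞} (h : S2 u) (h' : NonlinearAtInfinity u) :
    Admissible (fun x => (u x).toReal) := by
  obtain ⟨⟨-, -, h0⟩, hfin, hsc, hcd, hh⟩ := h
  refine ⟨by simp [h0], fun x => ENNReal.toReal_nonneg, hsc, hcd, hh, fun x hx => ?_⟩
  rintro ⟨a, b, ha, hb, H⟩
  refine (h' x hx).2 ⟨a, b, ha, hb, fun t ht => ⟨?_, ?_⟩⟩
  · exact ENNReal.ofReal_le_of_le_toReal (H t ht).1
  · rw [← ENNReal.ofReal_toReal (hfin (t • x))]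
    exact ENNReal.ofReal_le_ofReal (H t ht).2

theorem toReal_ofReal (hf : Admissible f) : (fun x => (ENNReal.ofReal (f x)).toReal) = f :=
  funext fun x => ENNReal.toReal_ofReal (hf.nonneg x)

theorem S2_ofReal (hf : Admissible f) : S2 (fun x => ENNReal.ofReal (f x)) := by
  refine ⟨⟨fun x y a b ha hb hab => ?_, ?_, by simp [hf.zero]⟩, fun x => ENNReal.ofReal_ne_top,
    ?_, ?_, fun x hx v hv => ?_⟩
  · rw [← ENNReal.ofReal_mul ha, ← ENNReal.ofReal_mul hb, ← ENNReal.ofReal_add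
      (mul_nonneg ha (hf.nonneg x)) (mul_nonneg hb (hf.nonneg y))]
    exact ENNReal.ofReal_le_ofReal (hf.convex.2 (mem_univ x) (mem_univ y) ha hb hab)
  · exact (ENNReal.continuous_ofReal.comp hf.continuous).lowerSemicontinuous
  · rw [hf.toReal_ofReal]
    exact hf.strictConvex
  · rw [hf.toReal_ofReal]
    exact hf.contDiffOn
  · rw [hf.toReal_ofReal]
    exact hf.hess_pos x hx v hv

theorem nonlinearAtInfinity_ofReal (hf : Admissible f) :
    NonlinearAtInfinity (fun x => ENNReal.ofReal (f x)) := by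
  refine fun x hx => ⟨fun t _ => ENNReal.ofReal_ne_top, ?_⟩
  rintro ⟨a, b, ha, hb, H⟩
  refine hf.nonlinear x hx ⟨a, b, ha, hb, fun t ht => ⟨?_, ?_⟩⟩
  · exact (ENNReal.ofReal_le_ofReal_iff (hf.nonneg _)).1 (H t ht).1
  · exact (ENNReal.ofReal_le_ofReal_iff (by positivity)).1 (H t ht).2

end Admissible

section Family

variable {f : ℝ → Euc n → ℝ} {A : Set ℝ} {t : ℝ} {x y : Euc n} {c : ℝ}

theorem contDiffAt_pol_time (hA : A ∈ 𝓝 t) (hf : ∀ s ∈ A, Admissible (f s))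
    (hW : ContDiffAt ℝ 2 (fun q : ℝ × Euc n => f q.1 q.2) (t, x)) (h : PolarDual (f t) x y c) :
    ContDiffAt ℝ 2 (fun r => pol (f r) y) t := by
  obtain ⟨X, U, hU, hUe⟩ := exists_localPolar_pol (mem_of_mem_nhds hA) hf hW h
  have hs : Tendsto (fun s : ℝ => (s, y)) (𝓝 t) (𝓝 (t, y)) :=
    (by fun_prop : Continuous fun s : ℝ => (s, y)).tendsto' _ _ rfl
  have h1 : ContDiffAt ℝ 2 (fun r => U (r, y)) t :=
    hU.contDiffAt.comp (f := fun r : ℝ => (r, y)) t (contDiffAt_id.prodMk contDiffAt_const)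
  refine h1.congr_of_eventuallyEq ?_
  filter_upwards [hs.eventually hUe, hA] with r hr hrA using (hr hrA).symm

theorem deriv_deriv_pol (hA : A ∈ 𝓝 t) (hf : ∀ s ∈ A, Admissible (f s))
    (hW : ContDiffAt ℝ 2 (fun q : ℝ × Euc n => f q.1 q.2) (t, x)) (h : PolarDual (f t) x y c)
    {q : Euc n} (hq : hess (f t) x q = gradient (fun z => deriv (fun s => f s z) t / f t z) x) :
    deriv (fun s => deriv (fun r => pol (f r) y) s) t = c * f t x *
      (deriv (fun s => deriv (fun r => (f r x)⁻¹) s) t +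
        ⟪gradient (fun z => deriv (fun s => f s z) t / f t z) x, q⟫) := by
  have ht := mem_of_mem_nhds hA
  obtain ⟨X, U, hU, hUe⟩ := exists_localPolar_pol ht hf hW h
  have hs : Tendsto (fun s : ℝ => (s, y)) (𝓝 t) (𝓝 (t, y)) :=
    (by fun_prop : Continuous fun s : ℝ => (s, y)).tendsto' _ _ rfl
  have he : (fun r => pol (f r) y) =ᶠ[𝓝 t] fun r => U (r, y) := by
    filter_upwards [hs.eventually hUe, hA] with r hr hrA using (hr hrA).symm
  have hc : U (t, y) = c := he.self_of_nhds.symm.trans (h.pol_eq (hf t ht))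
  rw [← hc, EventuallyEq.deriv_eq he.deriv]
  refine hU.deriv_deriv hW ((hf t ht).pos h.ne).ne' (fun v hv h0 => ?_) hq
  have := (hf t ht).hess_pos x h.ne v hv
  rw [show hess (f t) x v = 0 from h0, inner_zero_right] at this
  exact this.false

theorem eventually_forall_inner_lt
    (hc : ContinuousOn (fun q : ℝ × Euc n => f q.1 q.2) {q | q.1 ∈ A ∧ q.2 ≠ 0}) (ht : t ∈ A)
    {K : Set (Euc n)} (hK : IsCompact K) (hK0 : ∀ z ∈ K, z ≠ 0) {k : ℝ}
    (h : ∀ z ∈ K, ⟪z, y⟫ < k + c * f t z) :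
    ∀ᶠ s in 𝓝[A] t, ∀ z ∈ K, ⟪z, y⟫ < k + c * f s z := by
  have key : ∀ᶠ s in 𝓝 t, ∀ z ∈ K, s ∈ A → ⟪z, y⟫ < k + c * f s z := by
    refine hK.eventually_forall_of_forall_eventually fun z hz => ?_
    have h1 : ContinuousWithinAt (fun q : ℝ × Euc n => k + c * f q.1 q.2 - ⟪q.2, y⟫)
        {q | q.1 ∈ A ∧ q.2 ≠ 0} (t, z) :=
      ((hc (t, z) ⟨ht, hK0 z hz⟩).const_mul c |>.const_add k).sub
        (by fun_prop : Continuous fun q : ℝ × Euc n => ⟪q.2, y⟫).continuousWithinAt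
    have h2 := eventually_nhdsWithin_iff.1 (h1.eventually_const_lt (sub_pos.2 (h z hz)))
    have h3 : ∀ᶠ q in 𝓝 (t, z), (q : ℝ × Euc n).2 ≠ 0 :=
      continuousAt_snd.eventually_ne (hK0 z hz)
    filter_upwards [h2, h3] with q hq hq0 hqA using sub_pos.1 (hq ⟨hqA, hq0⟩)
  filter_upwards [nhdsWithin_le_nhds key, self_mem_nhdsWithin] with s hs hsA z hz using hs z hz hsA

theorem continuousOn_pol_time (hf : ∀ s ∈ A, Admissible (f s))
    (hc : ContinuousOn (fun q : ℝ × Euc n => f q.1 q.2) {q | q.1 ∈ A ∧ q.2 ≠ 0}) (hy : y ≠ 0) :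
    ContinuousOn (fun s => pol (f s) y) A := by
  intro t ht
  obtain ⟨x, h⟩ := (hf t ht).exists_polarDual_pol hy
  have hy0 := norm_pos_iff.2 hy
  refine tendsto_order.2 ⟨fun a ha => ?_, fun a ha => ?_⟩
  · have h0 := (hf t ht).pos h.ne
    have h1 : ContinuousWithinAt (fun s => f s x) A t :=
      (hc (t, x) ⟨ht, h.ne⟩).comp (f := fun s : ℝ => (s, x))
        (by fun_prop : Continuous fun s : ℝ => (s, x)).continuousWithinAt fun s hs => ⟨hs, h.ne⟩
    have h2 : a * f t x < ⟪x, y⟫ - 1 := by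
      rw [← h.eq]
      exact mul_lt_mul_of_pos_right ha h0
    filter_upwards [(h1.const_mul a).eventually_lt_const h2, self_mem_nhdsWithin] with s hs hsA
    have h3 := (hf s hsA).inner_le x y
    exact lt_of_mul_lt_mul_right (by linarith) ((hf s hsA).nonneg x)
  · obtain ⟨d, hd, hda⟩ := exists_between ha
    have hd0 : 0 < d := h.pos.trans hd
    have hdd := sub_pos.2 hd
    set r : ℝ := ‖y‖⁻¹ with hr
    have hr0 : 0 < r := inv_pos.2 hy0
    obtain ⟨C, hC, hC'⟩ := (hf t ht).exists_mul_norm_le hr0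
    obtain ⟨R, hR⟩ := exists_gt (max r (C / (d - pol (f t) y)))
    have hrR : r < R := (le_max_left _ _).trans_lt hR
    have hne : ∀ z : Euc n, r ≤ ‖z‖ → z ≠ 0 := fun z hz => norm_pos_iff.1 (hr0.trans_le hz)
    have hK : IsCompact (Metric.closedBall (0 : Euc n) R ∩ {z | r ≤ ‖z‖}) :=
      (isCompact_closedBall _ _).inter_right (isClosed_le continuous_const continuous_norm)
    have e1 := eventually_forall_inner_lt (y := y) (c := d) (k := 1) hc ht hK
      (fun z hz => hne z hz.2) fun z hz => by
        have h1 := h.le z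
        have h2 := mul_lt_mul_of_pos_right hd ((hf t ht).pos (hne z hz.2))
        linarith
    have e2 := eventually_forall_inner_lt (y := y) (c := d) (k := 0) hc ht
      (isCompact_sphere (0 : Euc n) R) (fun z hz => hne z (by simp at hz; rw [hz]; exact hrR.le))
      fun z hz => by
        have hz' : ‖z‖ = R := by simpa using hz
        have h1 := h.le z
        have h2 := hC' z (hz' ▸ hrR.le)
        have h3 : C < ‖z‖ * (d - pol (f t) y) := by
          rw [← div_lt_iff₀ hdd, hz']
          exact (le_max_right _ _).trans_lt hR
        have h4 : C * 1 < C * (f t z * (d - pol (f t) y)) := by nlinarith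
        have h5 := lt_of_mul_lt_mul_left h4 hC.le
        linarith
    filter_upwards [e1, e2, self_mem_nhdsWithin] with s h1 h2 hsA
    refine (pol_le hd0.le fun z => ?_).trans_lt hda
    have hfz := mul_nonneg hd0.le ((hf s hsA).nonneg z)
    rcases lt_or_ge ‖z‖ r with hz | hz
    · have h3 := real_inner_le_norm z y
      have h4 := mul_lt_mul_of_pos_right hz hy0
      rw [hr, inv_mul_cancel₀ hy0.ne'] at h4
      linarith
    rcases le_or_gt ‖z‖ R with hz' | hz'
    · exact (h1 z ⟨by simpa using hz', hz⟩).le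
    · have h3 := (hf s hsA).le_of_le_on_sphere (ψ := fun z => ⟪z, y⟫)
        (fun s _ z => real_inner_smul_left _ _ _) hd0.le (hr0.trans hrR)
        (fun z hz => by simpa using (h2 z (by simpa using hz)).le) z hz'.le
      linarith

end Family

theorem eq_affine_of_deriv2_eq_zero {φ : ℝ → ℝ} {T : ℝ} (hT : 0 < T)
    (hc : ContinuousOn φ (Icc 0 T)) (hd : ∀ t ∈ Ioo 0 T, ContDiffAt ℝ 2 φ t)
    (h : ∀ t ∈ Ioo 0 T, deriv (fun s => deriv φ s) t = 0) {t : ℝ} (ht : t ∈ Icc 0 T) :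
    φ t = (1 - t / T) * φ 0 + t / T * φ T := by
  have h1 : DifferentiableOn ℝ φ (interior (Icc 0 T)) := by
    rw [interior_Icc]
    exact fun s hs => ((hd s hs).differentiableAt two_ne_zero).differentiableWithinAt
  have h2 : DifferentiableOn ℝ (deriv φ) (interior (Icc 0 T)) := by
    rw [interior_Icc]
    exact fun s hs => (((hd s hs).derivWithin (m := 1) (by norm_num)).differentiableAt
      one_ne_zero).differentiableWithinAt
  have hconv := convexOn_of_deriv2_nonneg (convex_Icc 0 T) hc h1 h2 (by
    rw [interior_Icc]
    exact fun s hs => (h s hs).ge)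
  have hconc := concaveOn_of_deriv2_nonpos (convex_Icc 0 T) hc h1 h2 (by
    rw [interior_Icc]
    exact fun s hs => (h s hs).le)
  have ha : 0 ≤ 1 - t / T := sub_nonneg.2 ((div_le_one hT).2 ht.2)
  have hb : 0 ≤ t / T := div_nonneg ht.1 hT.le
  have e1 := hconv.2 (left_mem_Icc.2 hT.le) (right_mem_Icc.2 hT.le) ha hb (by ring)
  have e2 := hconc.2 (left_mem_Icc.2 hT.le) (right_mem_Icc.2 hT.le) ha hb (by ring)
  have e3 : (1 - t / T) • (0 : ℝ) + (t / T) • T = t := by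
    simp [hT.ne']
  rw [e3] at e1 e2
  exact le_antisymm e1 e2

/-- The affine interpolation of the polar transforms of `f₀` and `f₁`. -/
def polInterp (T : ℝ) (f₀ f₁ : Euc n → ℝ) (t : ℝ) (y : Euc n) : ℝ :=
  (1 - t / T) * pol f₀ y + t / T * pol f₁ y

section Interp

variable {T : ℝ} {f₀ f₁ : Euc n → ℝ}

theorem polInterp_zero : polInterp T f₀ f₁ 0 = pol f₀ := by
  funext y
  simp [polInterp]

theorem polInterp_self (hT : 0 < T) : polInterp T f₀ f₁ T = pol f₁ := by
  funext y
  simp [polInterp, hT.ne']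

theorem admissible_polInterp (hT : 0 < T) (hf₀ : Admissible f₀) (hf₁ : Admissible f₁) :
    ∀ t ∈ Icc 0 T, Admissible (polInterp T f₀ f₁ t) := fun _ ht =>
  hf₀.pol.convexCombination hf₁.pol (sub_nonneg.2 ((div_le_one hT).2 ht.2))
    (div_nonneg ht.1 hT.le) (by ring)

theorem contDiffAt_polInterp (hf₀ : Admissible f₀) (hf₁ : Admissible f₁) (t : ℝ) {y : Euc n}
    (hy : y ≠ 0) : ContDiffAt ℝ 2 (fun q : ℝ × Euc n => polInterp T f₀ f₁ q.1 q.2) (t, y) := by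
  have h0 : ContDiffAt ℝ 2 (fun q : ℝ × Euc n => pol f₀ q.2) (t, y) :=
    (hf₀.pol.contDiffAt hy).comp (f := fun q : ℝ × Euc n => q.2) (t, y) contDiffAt_snd
  have h1 : ContDiffAt ℝ 2 (fun q : ℝ × Euc n => pol f₁ q.2) (t, y) :=
    (hf₁.pol.contDiffAt hy).comp (f := fun q : ℝ × Euc n => q.2) (t, y) contDiffAt_snd
  have h2 : ContDiffAt ℝ 2 (fun q : ℝ × Euc n => q.1 / T) (t, y) := contDiffAt_fst.div_const T
  exact ((contDiffAt_const.sub h2).mul h0).add (h2.mul h1)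

theorem polarT_interp (hT : 0 < T) (hf₀ : Admissible f₀) (hf₁ : Admissible f₁) {t : ℝ}
    (ht : t ∈ Icc 0 T) :
    polarT (fun z => ENNReal.ofReal (1 - t / T) * polarT (fun x => ENNReal.ofReal (f₀ x)) z +
        ENNReal.ofReal (t / T) * polarT (fun x => ENNReal.ofReal (f₁ x)) z) =
      fun x => ENNReal.ofReal (pol (polInterp T f₀ f₁ t) x) := by
  have ha : 0 ≤ 1 - t / T := sub_nonneg.2 ((div_le_one hT).2 ht.2)
  have hb : 0 ≤ t / T := div_nonneg ht.1 hT.le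
  rw [← (admissible_polInterp hT hf₀ hf₁ t ht).polarT_eq]
  congr 1
  funext z
  rw [hf₀.polarT_eq, hf₁.polarT_eq, ← ENNReal.ofReal_mul ha, ← ENNReal.ofReal_mul hb,
    ← ENNReal.ofReal_add (mul_nonneg ha (pol_nonneg _ _)) (mul_nonneg hb (pol_nonneg _ _))]
  rfl

theorem contDiffWithinAt_pol_polInterp (hT : 0 < T) (hf₀ : Admissible f₀) (hf₁ : Admissible f₁)
    {t : ℝ} (ht : t ∈ Icc 0 T) {x : Euc n} (hx : x ≠ 0) :
    ContDiffWithinAt ℝ 2 (fun q : ℝ × Euc n => pol (polInterp T f₀ f₁ q.1) q.2)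
      {q | q.1 ∈ Icc 0 T} (t, x) := by
  obtain ⟨y, h⟩ := (admissible_polInterp hT hf₀ hf₁ t ht).exists_polarDual_pol hx
  obtain ⟨X, U, hU, hUe⟩ := exists_localPolar_pol ht (admissible_polInterp hT hf₀ hf₁)
    (contDiffAt_polInterp hf₀ hf₁ t h.ne) h
  refine hU.contDiffAt.contDiffWithinAt.congr_of_eventuallyEq_of_mem
    (eventually_nhdsWithin_iff.2 ?_) ht
  filter_upwards [hUe] with q hq hqA using (hq hqA).symm

/-- The polar interpolation solves the polar Monge–Ampère equation. -/
theorem pol_polInterp_equation (hT : 0 < T) (hf₀ : Admissible f₀) (hf₁ : Admissible f₁)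
    {t : ℝ} (ht : t ∈ Ioo 0 T) {x : Euc n} (hx : x ≠ 0) (v : ℝ → Euc n → ℝ)
    (hv : ∀ s, v s = pol (polInterp T f₀ f₁ s)) :
    ∃ q, hess (v t) x q = gradient (fun z => deriv (fun s => v s z) t / v t z) x ∧
      deriv (fun s => deriv (fun r => (v r x)⁻¹) s) t +
        ⟪gradient (fun z => deriv (fun s => v s z) t / v t z) x, q⟫ = 0 := by
  have htI := Ioo_subset_Icc_self ht
  have hA : Icc 0 T ∈ 𝓝 t := Icc_mem_nhds ht.1 ht.2
  have hw := admissible_polInterp hT hf₀ hf₁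
  have hva : ∀ s ∈ Icc 0 T, Admissible (v s) := fun s hs => by
    rw [hv]
    exact (hw s hs).pol
  have hW : ContDiffAt ℝ 2 (fun q : ℝ × Euc n => v q.1 q.2) (t, x) := by
    simp only [hv]
    refine (contDiffWithinAt_pol_polInterp hT hf₀ hf₁ htI hx).contDiffAt ?_
    exact continuousAt_fst.preimage_mem_nhds hA
  obtain ⟨y, h⟩ := (hw t htI).exists_polarDual_pol hx
  have hdual := (hw t htI).polarDual_pol h
  rw [← hv] at hdual
  obtain ⟨q, hq⟩ : ∃ q, hess (v t) x q =
      gradient (fun z => deriv (fun s => v s z) t / v t z) x := by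
    have hinj : Function.Injective (hess (v t) x : Euc n →ₗ[ℝ] Euc n) := by
      refine (injective_iff_map_eq_zero _).2 fun w hw0 => ?_
      by_contra hne
      have := (hva t htI).hess_pos x hx w hne
      rw [show hess (v t) x w = 0 from hw0, inner_zero_right] at this
      exact this.false
    exact LinearMap.injective_iff_surjective.1 hinj _
  refine ⟨q, hq, ?_⟩
  have key := deriv_deriv_pol hA hva hW hdual hq
  have he : (fun r => pol (v r) y) =ᶠ[𝓝 t] fun r => polInterp T f₀ f₁ r y := by
    filter_upwards [hA] with r hr
    rw [hv, (hw r hr).pol_pol]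
  have hd : ∀ s, deriv (fun r => polInterp T f₀ f₁ r y) s = (pol f₁ y - pol f₀ y) / T := by
    intro s
    have h1 := (hasDerivAt_id s).div_const T
    have h2 := ((h1.const_sub 1).mul_const (pol f₀ y)).fun_add (h1.mul_const (pol f₁ y))
    refine h2.deriv.trans ?_
    ring
  rw [EventuallyEq.deriv_eq he.deriv] at key
  rw [funext hd, deriv_const] at key
  refine (mul_eq_zero.1 key.symm).resolve_left ?_
  exact (mul_pos hdual.pos ((hva t htI).pos hx)).ne'

/-- A solution of the polar Monge–Ampère equation is the polar transform of an affine family. -/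
theorem pol_eq_polInterp (hT : 0 < T) {f : ℝ → Euc n → ℝ} (hf : ∀ t ∈ Icc 0 T, Admissible (f t))
    (hc : ContDiffOn ℝ 2 (fun q : ℝ × Euc n => f q.1 q.2) {q | q.1 ∈ Icc 0 T ∧ q.2 ≠ 0})
    (heq : ∀ t ∈ Ioo 0 T, ∀ x : Euc n, x ≠ 0 → ∃ q : Euc n,
      hess (f t) x q = gradient (fun z => deriv (fun s => f s z) t / f t z) x ∧
      deriv (fun s => deriv (fun r => (f r x)⁻¹) s) t +
        ⟪gradient (fun z => deriv (fun s => f s z) t / f t z) x, q⟫ = 0)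
    {t : ℝ} (ht : t ∈ Icc 0 T) : pol (f t) = polInterp T (f 0) (f T) t := by
  funext y
  rcases eq_or_ne y 0 with rfl | hy
  · simp [polInterp, pol_zero]
  have hloc : ∀ s ∈ Ioo 0 T, ContDiffAt ℝ 2 (fun r => pol (f r) y) s ∧
      deriv (fun s => deriv (fun r => pol (f r) y) s) s = 0 := by
    intro s hs
    have hA : Icc 0 T ∈ 𝓝 s := Icc_mem_nhds hs.1 hs.2
    obtain ⟨x, h⟩ := (hf s (Ioo_subset_Icc_self hs)).exists_polarDual_pol hy
    have hW : ContDiffAt ℝ 2 (fun q : ℝ × Euc n => f q.1 q.2) (s, x) := by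
      refine hc.contDiffAt ?_
      filter_upwards [continuousAt_fst.preimage_mem_nhds (x := (s, x)) hA,
        continuousAt_snd.eventually_ne (x := (s, x)) h.ne] with q h1 h2 using ⟨h1, h2⟩
    obtain ⟨q, hq, hq'⟩ := heq s hs x h.ne
    refine ⟨contDiffAt_pol_time hA hf hW h, ?_⟩
    rw [deriv_deriv_pol hA hf hW h hq, hq', mul_zero]
  exact eq_affine_of_deriv2_eq_zero hT (continuousOn_pol_time hf hc.continuousOn hy)
    (fun s hs => (hloc s hs).1) (fun s hs => (hloc s hs).2) ht

end Interp

end PolarMongeAmpere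

open PolarMongeAmpere

/-- Theorem 7.1: the Dirichlet problem for the homogeneous polar Monge–Ampère equation with
boundary data `u₀, u_T ∈ S₂` nonlinear at infinity has the unique solution
`u(t,·) = P((1 - t/T)·P(u₀) + (t/T)·P(u_T))`. -/
theorem stmt_15 {n : ℕ} (T : ℝ) (hT : 0 < T) (u₀ uT : Euc n → ℝ≥0∞)
    (h₀ : S2 u₀) (h₀' : NonlinearAtInfinity u₀)
    (h₁ : S2 uT) (h₁' : NonlinearAtInfinity uT) :
    IsSolutionHPMA T u₀ uT (fun t => polarT (fun z =>
        ENNReal.ofReal (1 - t / T) * polarT u₀ z + ENNReal.ofReal (t / T) * polarT uT z)) ∧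
    ∀ u : ℝ → Euc n → ℝ≥0∞, IsSolutionHPMA T u₀ uT u → ∀ t ∈ Icc (0:ℝ) T,
      u t = polarT (fun z =>
        ENNReal.ofReal (1 - t / T) * polarT u₀ z + ENNReal.ofReal (t / T) * polarT uT z) := by
  have of_toReal : ∀ {w : Euc n → ℝ≥0∞}, S2 w → w = fun x => ENNReal.ofReal (w x).toReal :=
    fun {w} hw => funext fun x => (ENNReal.ofReal_toReal (hw.2.1 x)).symm
  have hf₀ := Admissible.of_S2 h₀ h₀'
  have hf₁ := Admissible.of_S2 h₁ h₁'
  have hu₀ := of_toReal h₀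
  have hu₁ := of_toReal h₁
  set f₀ : Euc n → ℝ := fun x => (u₀ x).toReal with hf₀_def
  set f₁ : Euc n → ℝ := fun x => (uT x).toReal with hf₁_def
  have h0I : (0 : ℝ) ∈ Icc 0 T := left_mem_Icc.2 hT.le
  have hTI : T ∈ Icc 0 T := right_mem_Icc.2 hT.le
  have hpol : ∀ t ∈ Icc 0 T, polarT (fun z =>
      ENNReal.ofReal (1 - t / T) * polarT u₀ z + ENNReal.ofReal (t / T) * polarT uT z) =
      fun x => ENNReal.ofReal (pol (polInterp T f₀ f₁ t) x) := fun t ht => by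
    rw [hu₀, hu₁]
    exact polarT_interp hT hf₀ hf₁ ht
  have hw := admissible_polInterp hT hf₀ hf₁
  refine ⟨?_, fun u hu t ht => ?_⟩
  · generalize hu_def : (fun t : ℝ => polarT (fun z =>
        ENNReal.ofReal (1 - t / T) * polarT u₀ z + ENNReal.ofReal (t / T) * polarT uT z)) = u
    have hu : ∀ t ∈ Icc 0 T, u t = fun x => ENNReal.ofReal (pol (polInterp T f₀ f₁ t) x) := by
      intro t ht
      rw [← hu_def]
      exact hpol t ht
    have hur : ∀ t ∈ Icc 0 T, ∀ x, (u t x).toReal = pol (polInterp T f₀ f₁ t) x := by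
      intro t ht x
      rw [hu t ht, ENNReal.toReal_ofReal (pol_nonneg _ _)]
    refine ⟨fun t ht => ?_, ?_, ?_, ?_, fun t ht x hx => ?_⟩
    · rw [hu t ht]
      exact ⟨(hw t ht).pol.S2_ofReal, (hw t ht).pol.nonlinearAtInfinity_ofReal⟩
    · rw [hu 0 h0I, polInterp_zero, hf₀.pol_pol, ← hu₀]
    · rw [hu T hTI, polInterp_self hT, hf₁.pol_pol, ← hu₁]
    · rintro ⟨t, x⟩ ⟨ht, hx⟩
      refine ((contDiffWithinAt_pol_polInterp hT hf₀ hf₁ ht hx).mono fun q hq => hq.1).congr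
        (fun q hq => hur _ hq.1 _) (hur _ ht _)
    · have hA : Icc 0 T ∈ 𝓝 t := Icc_mem_nhds ht.1 ht.2
      obtain ⟨q, h1, h2⟩ := pol_polInterp_equation hT hf₀ hf₁ ht hx _ fun _ => rfl
      have e1 : ∀ z, deriv (fun s => (u s z).toReal) t =
          deriv (fun s => pol (polInterp T f₀ f₁ s) z) t := fun z => by
        refine EventuallyEq.deriv_eq ?_
        filter_upwards [hA] with s hs using hur s hs z
      have e2 : deriv (fun s => deriv (fun r => ((u r x).toReal)⁻¹) s) t =
          deriv (fun s => deriv (fun r => (pol (polInterp T f₀ f₁ r) x)⁻¹) s) t := by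
        refine EventuallyEq.deriv_eq (EventuallyEq.deriv ?_)
        filter_upwards [hA] with s hs
        rw [hur s hs x]
      refine ⟨q, ?_, ?_⟩
      · simp only [e1, hur t (Ioo_subset_Icc_self ht)]
        exact h1
      · rw [e2]
        simp only [e1, hur t (Ioo_subset_Icc_self ht)]
        exact h2
  · obtain ⟨hS, hu0, huT, hcd, heq⟩ := hu
    have hf : ∀ s ∈ Icc 0 T, Admissible (fun x => (u s x).toReal) := fun s hs =>
      Admissible.of_S2 (hS s hs).1 (hS s hs).2
    have key := pol_eq_polInterp hT hf hcd heq ht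
    simp only [hu0, huT] at key
    rw [hpol t ht, of_toReal (hS t ht).1, ← key, (hf t ht).pol_pol]
end
end

section
/- Let f ∈ Cvx₀(ℝⁿ). Then the polar subdifferential map of Pf is the inverse of that of f: for all x ∈ dom(f) and y ∈ dom(Pf), one has y ∈ ∂°f(x) if and only if x ∈ ∂°(Pf)(y). -/
open scoped ENNReal RealInnerProductSpace
open Set

noncomputable section

/-- The Fenchel-type inequality `⟨x,y⟩ ≤ 1 + Pf(y)·f(x)` for `x ∈ dom f`, `y ∈ dom Pf`. -/
theorem ofReal_inner_le_one_add_polarT_mul {n : ℕ} (f : Euc n → ℝ≥0∞) {x y : Euc n}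
    (hx : f x ≠ ∞) (hy : polarT f y ≠ ∞) :
    ENNReal.ofReal ⟪x, y⟫ ≤ 1 + polarT f y * f x := by
  have hcont : Continuous fun c : ℝ≥0∞ => 1 + c * f x :=
    continuous_const.add (ENNReal.continuous_mul_const hx)
  have hclosed : IsClosed {c : ℝ≥0∞ | ENNReal.ofReal ⟪x, y⟫ ≤ 1 + c * f x} :=
    isClosed_le continuous_const hcont
  obtain ⟨k, hk, -⟩ := sInf_lt_iff.1 hy.lt_top
  have hsub : {c : ℝ≥0∞ | ∀ z : Euc n, ENNReal.ofReal ⟪z, y⟫ ≤ 1 + c * f z} ⊆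
      {c : ℝ≥0∞ | ENNReal.ofReal ⟪x, y⟫ ≤ 1 + c * f x} := fun c hc => hc x
  exact closure_minimal hsub hclosed (csInf_mem_closure ⟨k, hk⟩ (OrderBot.bddBelow _))

/-- The double polarity transform is bounded by `f` on the domain of `f`. -/
theorem polarT_polarT_le {n : ℕ} (f : Euc n → ℝ≥0∞) {x : Euc n} (hx : f x ≠ ∞) :
    polarT (polarT f) x ≤ f x := by
  refine le_of_forall_gt fun c hc => ?_
  obtain ⟨d, hd, hdc⟩ := exists_between hc
  refine (sInf_le fun y => ?_).trans_lt hdc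
  by_cases hy : polarT f y = ∞
  · simp [hy, ENNReal.mul_top (pos_of_gt hd).ne']
  · rw [real_inner_comm, mul_comm]
    exact (ofReal_inner_le_one_add_polarT_mul f hx hy).trans (by gcongr)

/-- A point strictly below the graph of a geometric convex function is cut off by an affine
functional of the form `z ↦ (⟨z,y⟩ - 1) / s` with `s > 0`. -/
theorem GeomConvexOn.exists_affine_separation {n : ℕ} {f : Euc n → ℝ≥0∞}
    (hf : GeomConvexOn f) {x : Euc n} {c : ℝ} (hc : 0 ≤ c) (hcx : ENNReal.ofReal c < f x) :
    ∃ (y : Euc n) (s : ℝ), 0 < s ∧ 1 + c * s < ⟪x, y⟫ ∧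
      ∀ z, ENNReal.ofReal ⟪z, y⟫ ≤ 1 + ENNReal.ofReal s * f z := by
  obtain ⟨hconv, hlsc, h0⟩ := hf
  set S : Set (Euc n × ℝ) := {p | f p.1 ≤ ENNReal.ofReal p.2 ∧ 0 ≤ p.2} with hS
  have hSc : IsClosed S := by
    refine IsClosed.inter ?_ (isClosed_le continuous_const continuous_snd)
    exact hlsc.isClosed_epigraph.preimage
      (continuous_fst.prodMk (ENNReal.continuous_ofReal.comp continuous_snd))
  have hSconv : Convex ℝ S := by
    rintro ⟨z, t⟩ ⟨hz, ht⟩ ⟨w, r⟩ ⟨hw, hr⟩ a b ha hb hab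
    simp only at hz ht hw hr
    refine ⟨(hconv z w a b ha hb hab).trans ?_, ?_⟩
    · simp only [Prod.snd_add, Prod.smul_snd, smul_eq_mul]
      rw [ENNReal.ofReal_add (by positivity) (by positivity), ENNReal.ofReal_mul ha,
        ENNReal.ofReal_mul hb]
      gcongr
    · simp only [Prod.snd_add, Prod.smul_snd, smul_eq_mul]
      positivity
  obtain ⟨g, u, hgS, hgx⟩ := geometric_hahn_banach_closed_point hSconv hSc
    (x := (x, c)) (fun h => h.1.not_gt hcx)
  have hg : ∀ z t, g (z, t) = g (z, 0) + t * g (0, 1) := fun z t => by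
    rw [← smul_eq_mul, ← map_smul, ← map_add]
    simp
  have hu : 0 < u := by
    simpa only [Prod.mk_zero_zero, map_zero] using hgS (0, 0) (by simp [hS, h0])
  have hs : g (0, 1) ≤ 0 := by
    by_contra! h
    have hlt := hgS (0, u / g (0, 1)) ⟨by simp [h0], by positivity⟩
    rw [hg, div_mul_cancel₀ _ h.ne', Prod.mk_zero_zero, map_zero, zero_add] at hlt
    exact hlt.false
  set a : Euc n := (InnerProductSpace.toDual ℝ (Euc n)).symm
    (g.comp (ContinuousLinearMap.inl ℝ (Euc n) ℝ)) with ha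
  have hinner : ∀ z, ⟪z, u⁻¹ • a⟫ = g (z, 0) / u := fun z => by
    rw [real_inner_smul_right, real_inner_comm, ha, InnerProductSpace.toDual_symm_apply]
    simp [div_eq_inv_mul]
  set s : ℝ := -g (0, 1) / u with hs_def
  have hs0 : 0 ≤ s := div_nonneg (by linarith) hu.le
  have hd : 0 < ⟪x, u⁻¹ • a⟫ - 1 - c * s := by
    have : ⟪x, u⁻¹ • a⟫ - 1 - c * s = (g (x, c) - u) / u := by
      rw [hinner, hg x c, hs_def]
      field_simp
      ring
    rw [this]
    exact div_pos (by linarith) hu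
  set d : ℝ := ⟪x, u⁻¹ • a⟫ - 1 - c * s with hd_def
  refine ⟨u⁻¹ • a, s + d / (c + 1), by positivity, ?_, fun z => ?_⟩
  · have : c * (d / (c + 1)) < d := by
      rw [← mul_div_assoc, div_lt_iff₀ (by positivity)]
      nlinarith
    linarith
  · have hpos : 0 < s + d / (c + 1) := by positivity
    by_cases hz : f z = ∞
    · simp [hz, ENNReal.mul_top, hpos]
    · have hlt := hgS (z, (f z).toReal) ⟨by simp [ENNReal.ofReal_toReal hz], by simp⟩
      rw [hg] at hlt
      have hle : ⟪z, u⁻¹ • a⟫ ≤ 1 + s * (f z).toReal := by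
        rw [hinner, div_le_iff₀ hu, hs_def]
        field_simp
        linarith
      rw [← ENNReal.ofReal_toReal hz, ← ENNReal.ofReal_mul hpos.le, ← ENNReal.ofReal_one,
        ← ENNReal.ofReal_add zero_le_one (by positivity)]
      refine ENNReal.ofReal_le_ofReal (hle.trans ?_)
      gcongr
      exact le_add_of_nonneg_right (by positivity)

/-- A geometric convex function is bounded by its double polarity transform. -/
theorem GeomConvexOn.le_polarT_polarT {n : ℕ} {f : Euc n → ℝ≥0∞} (hf : GeomConvexOn f)
    (x : Euc n) : f x ≤ polarT (polarT f) x := by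
  by_contra! h
  obtain ⟨c, hc, hcx⟩ := ENNReal.lt_iff_exists_nnreal_btwn.1 h
  rw [← ENNReal.ofReal_coe_nnreal] at hc hcx
  obtain ⟨y, s, hs, hlt, hle⟩ := hf.exists_affine_separation c.coe_nonneg hcx
  obtain ⟨k, hk, hkc⟩ := sInf_lt_iff.1 hc
  have hys : polarT f y ≤ ENNReal.ofReal s := sInf_le hle
  have hmul : ENNReal.ofReal ⟪y, x⟫ ≤ 1 + ENNReal.ofReal c * ENNReal.ofReal s :=
    (hk y).trans (by gcongr)
  rw [← ENNReal.ofReal_mul c.coe_nonneg, ← ENNReal.ofReal_one,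
    ← ENNReal.ofReal_add zero_le_one (by positivity),
    ENNReal.ofReal_le_ofReal_iff (by positivity), real_inner_comm] at hmul
  exact hmul.not_gt hlt

/-- The polarity transform is an involution on the domain of a geometric convex function. -/
theorem GeomConvexOn.polarT_polarT {n : ℕ} {f : Euc n → ℝ≥0∞} (hf : GeomConvexOn f)
    {x : Euc n} (hx : f x ≠ ∞) : polarT (polarT f) x = f x :=
  (polarT_polarT_le f hx).antisymm (hf.le_polarT_polarT x)

/-- For `f ∈ Cvx₀(ℝⁿ)`, the polar subdifferential of `Pf` is the inverse of that of `f`: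
`y ∈ ∂°f(x) ↔ x ∈ ∂°(Pf)(y)` for `x ∈ dom f`, `y ∈ dom Pf`. -/
theorem stmt_19 {n : ℕ} (f : Euc n → ℝ≥0∞) (hf : GeomConvexOn f) :
    ∀ x y : Euc n, f x ≠ ∞ → polarT f y ≠ ∞ →
      (y ∈ polarSubdiff f x ↔ x ∈ polarSubdiff (polarT f) y) := by
  intro x y hx hy
  simp only [polarSubdiff, mem_ofPred_eq, hf.polarT_polarT hx, real_inner_comm x y, mul_comm,
    ne_eq, hx, hy, not_false_eq_true, true_and]
end
end
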